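/- arXiv:2503.11092 — 10 statements merged into one kernel-verified Lean document; each statement's English description precedes it below -/
import Mathlib

section
/- Let ξ ∈ ℝ² with ξ ≠ 0, and let g : ℝ² → ℂ be measurable. Assume that the functions η ↦ (ξ·η^⊥)/(‖ξ‖²‖η‖) · g(ξ−η)g(η), η ↦ (ξ·η^⊥)/(‖ξ‖²‖ξ−η‖) · g(ξ−η)g(η), and η ↦ (ξ·η^⊥)(ξ·(2η−ξ))/(‖ξ‖²(‖η‖+‖ξ−η‖)‖ξ−η‖‖η‖) · g(ξ−η)g(η) (interpreted as 0 at η = 0 and η = ξ) are integrable on ℝ². Then − ∫_{ℝ²} (ξ·η^⊥)/(‖ξ‖²‖η‖) · g(ξ−η)g(η) dη = (1/2) ∫_{ℝ²} (ξ·η^⊥)(ξ·(2η−ξ))/(‖ξ‖²(‖η‖+‖ξ−η‖)‖ξ−η‖‖η‖) · g(ξ−η)g(η) dη. -/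
open MeasureTheory Complex
open scoped RealInnerProductSpace ENNReal NNReal

noncomputable section

abbrev E2 : Type := EuclideanSpace ℝ (Fin 2)

/-- Rotation by 90 degrees: `η^⊥ = (-η₂, η₁)`. -/
def perp (η : E2) : E2 := (WithLp.equiv 2 (Fin 2 → ℝ)).symm ![-η 1, η 0]

/-- The first standard basis vector `e₁ = (1,0)`. -/
def e1 : E2 := EuclideanSpace.single 0 1

/-- The unit vector `a = (1/√2, 1/√2)`. -/
def aVec : E2 := (WithLp.equiv 2 (Fin 2 → ℝ)).symm ![1 / Real.sqrt 2, 1 / Real.sqrt 2]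

/-- Fourier transform `ĥ(ξ) = ∫ e^{-i x·ξ} h(x) dx`. -/
def FT (h : E2 → ℂ) (ξ : E2) : ℂ :=
  ∫ x : E2, Complex.exp (-(Complex.I * ((⟪x, ξ⟫ : ℝ) : ℂ))) * h x

theorem inner_perp_self (ξ : E2) : ⟪ξ, perp ξ⟫ = 0 := by
  simp [perp, PiLp.inner_apply, Fin.sum_univ_two]
  ring

theorem inner_perp_sub (ξ η : E2) : ⟪ξ, perp (ξ - η)⟫ = -⟪ξ, perp η⟫ := by
  simp [perp, PiLp.inner_apply, Fin.sum_univ_two]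
  ring

theorem inner_perp_zero (ξ : E2) : ⟪ξ, perp 0⟫ = 0 := by
  simp [perp, PiLp.inner_apply, Fin.sum_univ_two]

theorem inner_two_smul_sub (ξ η : E2) :
    ⟪ξ, (2 : ℝ) • η - ξ⟫ = ‖η‖ ^ 2 - ‖ξ - η‖ ^ 2 := by
  rw [norm_sub_sq_real, inner_sub_right, inner_smul_right, real_inner_self_eq_norm_sq]
  ring

/-- The symmetrized quasi-geostrophic symbol in double-divergence form. -/
theorem symbol_eq_sub (ξ η : E2) (hξ : ξ ≠ 0) :
    ⟪ξ, perp η⟫ * ⟪ξ, (2 : ℝ) • η - ξ⟫ /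
        (‖ξ‖ ^ 2 * (‖η‖ + ‖ξ - η‖) * ‖ξ - η‖ * ‖η‖) =
      ⟪ξ, perp η⟫ / (‖ξ‖ ^ 2 * ‖ξ - η‖) - ⟪ξ, perp η⟫ / (‖ξ‖ ^ 2 * ‖η‖) := by
  rcases eq_or_ne η 0 with rfl | hη
  · simp [inner_perp_zero]
  rcases eq_or_ne ξ η with rfl | hξη
  · simp [inner_perp_self]
  have h₁ : 0 < ‖ξ‖ := norm_pos_iff.2 hξ
  have h₂ : 0 < ‖η‖ := norm_pos_iff.2 hη
  have h₃ : 0 < ‖ξ - η‖ := norm_pos_iff.2 (sub_ne_zero.2 hξη)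
  rw [inner_two_smul_sub]
  field_simp
  ring

/-- double-divergence rewriting of the quasi-geostrophic symbol. -/
theorem stmt2 (ξ : E2) (hξ : ξ ≠ 0) (g : E2 → ℂ) (hg : Measurable g)
    (h1 : Integrable (fun η : E2 =>
      ((⟪ξ, perp η⟫ / (‖ξ‖ ^ 2 * ‖η‖) : ℝ) : ℂ) * g (ξ - η) * g η))
    (h2 : Integrable (fun η : E2 =>
      ((⟪ξ, perp η⟫ / (‖ξ‖ ^ 2 * ‖ξ - η‖) : ℝ) : ℂ) * g (ξ - η) * g η))
    (h3 : Integrable (fun η : E2 =>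
      ((⟪ξ, perp η⟫ * ⟪ξ, (2 : ℝ) • η - ξ⟫ /
        (‖ξ‖ ^ 2 * (‖η‖ + ‖ξ - η‖) * ‖ξ - η‖ * ‖η‖) : ℝ) : ℂ) * g (ξ - η) * g η)) :
    -(∫ η : E2, ((⟪ξ, perp η⟫ / (‖ξ‖ ^ 2 * ‖η‖) : ℝ) : ℂ) * g (ξ - η) * g η) =
      (1 / 2 : ℂ) * ∫ η : E2,
        ((⟪ξ, perp η⟫ * ⟪ξ, (2 : ℝ) • η - ξ⟫ /
          (‖ξ‖ ^ 2 * (‖η‖ + ‖ξ - η‖) * ‖ξ - η‖ * ‖η‖) : ℝ) : ℂ) * g (ξ - η) * g η := by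
  have hsub : ∫ η : E2, ((⟪ξ, perp η⟫ / (‖ξ‖ ^ 2 * ‖η‖) : ℝ) : ℂ) * g (ξ - η) * g η =
      -∫ η : E2, ((⟪ξ, perp η⟫ / (‖ξ‖ ^ 2 * ‖ξ - η‖) : ℝ) : ℂ) * g (ξ - η) * g η := by
    rw [← integral_sub_left_eq_self _ volume ξ, ← integral_neg]
    refine integral_congr_ae (.of_forall fun η => ?_)
    simp only [sub_sub_cancel, inner_perp_sub, neg_div, ofReal_neg]
    ring
  simp only [symbol_eq_sub _ _ hξ, ofReal_sub, sub_mul]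
  rw [integral_sub h2 h1, hsub]
  ring
end
end

section
/- Let φ₀ be a dyadic partition function and define, for j ∈ ℤ and ξ ∈ ℝ², ψ̂_j(ξ) := 1 − Σ_{k = j−10}^{∞} φ̂₀(2^{−k}(ξ − 2^j a)), where a := (1/√2, 1/√2). Then for every j ∈ ℤ and every ξ ∈ ℝ², φ̂₀(2^{−j}ξ) · ψ̂_j(ξ) = ψ̂_j(ξ). -/
open MeasureTheory Complex
open scoped RealInnerProductSpace ENNReal NNReal

noncomputable section

/-- A dyadic partition function: a Schwartz function `φ₀` together with its
(real-valued) Fourier transform `Φ` satisfying the standard Littlewood--Paley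
conditions. -/
structure DyadicData where
  φ : SchwartzMap E2 ℂ
  Φ : E2 → ℝ
  hFT : ∀ ξ : E2, FT (fun x => φ x) ξ = ((Φ ξ : ℝ) : ℂ)
  h0 : ∀ ξ : E2, 0 ≤ Φ ξ
  h1 : ∀ ξ : E2, Φ ξ ≤ 1
  hsupp : ∀ ξ : E2, Φ ξ ≠ 0 → 1 / 2 ≤ ‖ξ‖ ∧ ‖ξ‖ ≤ 2
  hone : ∀ ξ : E2, 7 / 8 ≤ ‖ξ‖ → ‖ξ‖ ≤ 5 / 4 → Φ ξ = 1
  hsum : ∀ ξ : E2, ξ ≠ 0 → HasSum (fun k : ℤ => Φ ((2 : ℝ) ^ (-k) • ξ)) 1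

/-- `ψ̂_j(ξ) = 1 − Σ_{k ≥ j−10} φ̂₀(2^{−k}(ξ − 2^j a))`. -/
def psiHat (D : DyadicData) (j : ℤ) (ξ : E2) : ℝ :=
  1 - ∑' k : ℕ, D.Φ ((2 : ℝ) ^ (-(j - 10 + (k : ℤ))) • (ξ - (2 : ℝ) ^ j • aVec))

theorem norm_aVec : ‖aVec‖ = 1 := by
  simp [aVec, EuclideanSpace.norm_eq, Fin.sum_univ_two]
  norm_num

/-- Away from `2 ^ j • aVec` (at distance more than `2 ^ j / 8`) the function `psiHat` vanishes. -/
theorem psiHat_eq_zero (D : DyadicData) (j : ℤ) (ξ : E2)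
    (h : (2 : ℝ) ^ j / 8 < ‖ξ - (2 : ℝ) ^ j • aVec‖) : psiHat D j ξ = 0 := by
  have hj : (0 : ℝ) < 2 ^ j := by positivity
  have hne : ξ - (2 : ℝ) ^ j • aVec ≠ 0 := norm_pos_iff.1 (lt_trans (by positivity) h)
  have hinj : Function.Injective (fun k : ℕ => j - 10 + (k : ℤ)) := by
    intro k l hkl
    simpa using hkl
  have hs := (hinj.hasSum_iff (a := (1 : ℝ)) ?_).2 (D.hsum _ hne)
  · rw [psiHat, sub_eq_zero]
    exact hs.tsum_eq.symm
  · intro k hk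
    have hkj : k ≤ j - 10 := by
      by_contra! hlt
      exact hk ⟨(k - (j - 10)).toNat, by simp only; omega⟩
    by_contra hΦ
    have hle := (D.hsupp _ hΦ).2
    have hk0 : (0 : ℝ) < 2 ^ k := by positivity
    rw [norm_smul, Real.norm_of_nonneg (by positivity), zpow_neg, inv_mul_le_iff₀ hk0] at hle
    have hpow : (2 : ℝ) ^ k ≤ 2 ^ j / 2 ^ 10 := by
      have := zpow_le_zpow_right₀ (by norm_num : (1 : ℝ) ≤ 2) hkj
      rw [zpow_sub₀ (by norm_num)] at this
      exact_mod_cast this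
    linarith

/-- On the ball of radius `2 ^ j / 8` around `2 ^ j • aVec` the dilated cutoff equals one. -/
theorem DyadicData.dilate_eq_one (D : DyadicData) (j : ℤ) (ξ : E2)
    (h : ‖ξ - (2 : ℝ) ^ j • aVec‖ ≤ (2 : ℝ) ^ j / 8) : D.Φ ((2 : ℝ) ^ (-j) • ξ) = 1 := by
  have hj : (0 : ℝ) < 2 ^ j := by positivity
  have ha : ‖(2 : ℝ) ^ j • aVec‖ = 2 ^ j := by
    rw [norm_smul, norm_aVec, mul_one, Real.norm_of_nonneg hj.le]
  have hdist := abs_le.1 ((abs_norm_sub_norm_le ξ ((2 : ℝ) ^ j • aVec)).trans h)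
  rw [ha] at hdist
  have hnorm : ‖(2 : ℝ) ^ (-j) • ξ‖ = ‖ξ‖ / 2 ^ j := by
    rw [norm_smul, Real.norm_of_nonneg (by positivity), zpow_neg, inv_mul_eq_div]
  apply D.hone
  · rw [hnorm, le_div_iff₀ hj]
    linarith
  · rw [hnorm, div_le_iff₀ hj]
    linarith

/-- the Fourier-side identity `φ̂₀(2^{−j}·) ψ̂_j = ψ̂_j`
(i.e. `ψ_j = φ_j ∗ ψ_j`). -/
theorem stmt7 (D : DyadicData) (j : ℤ) (ξ : E2) :
    D.Φ ((2 : ℝ) ^ (-j) • ξ) * psiHat D j ξ = psiHat D j ξ := by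
  rcases le_or_gt ‖ξ - (2 : ℝ) ^ j • aVec‖ ((2 : ℝ) ^ j / 8) with h | h
  · rw [D.dilate_eq_one j ξ h, one_mul]
  · rw [psiHat_eq_zero D j ξ h, mul_zero]
end
end

section
/- Let χ : ℝ² → ℝ be a Schwartz function whose Fourier transform satisfies 0 ≤ χ̂ ≤ 1 everywhere, χ̂(ζ) = 1 for ‖ζ‖ ≤ 1, and χ̂(ζ) = 0 for ‖ζ‖ ≥ 2. There exist absolute constants 0 < c < C such that for every integer N ≥ 100 and every ξ = (ξ₁, ξ₂) ∈ ℝ² with 0 < ‖ξ‖ ≤ 1, ξ₁ ≥ ‖ξ‖/4 and ξ₂ ≥ ‖ξ‖/4, one has c ≤ 2^{5N} · (ξ₁ξ₂/‖ξ‖²) · ∫_{ℝ²} η₁² / ((‖ξ−η‖ + ‖η‖) ‖ξ−η‖³ ‖η‖³) · χ̂(ξ − η + 2^N e₁) · χ̂(η − 2^N e₁) dη ≤ C. -/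
open MeasureTheory Complex
open scoped RealInnerProductSpace ENNReal NNReal

noncomputable section

/-- The Fourier transform of an integrable function is continuous. -/
theorem continuous_FT {h : E2 → ℂ} (hh : Integrable h) : Continuous (FT h) := by
  refine continuous_of_dominated (bound := fun x => ‖h x‖) (fun ξ => ?_) (fun ξ => ?_) hh.norm ?_
  · exact (Continuous.aestronglyMeasurable (by fun_prop)).mul hh.aestronglyMeasurable
  · refine Filter.Eventually.of_forall fun x => ?_
    rw [norm_mul, Complex.norm_exp]
    simp
  · exact Filter.Eventually.of_forall fun x => by fun_prop

theorem norm_e1 : ‖e1‖ = 1 := by simp [e1]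

/-- The kernel of the main term of the second Picard iterate. -/
def picardKernel (ξ η : E2) : ℝ :=
  (η 0) ^ 2 / ((‖ξ - η‖ + ‖η‖) * ‖ξ - η‖ ^ 3 * ‖η‖ ^ 3)

theorem picardKernel_nonneg (ξ η : E2) : 0 ≤ picardKernel ξ η := by
  unfold picardKernel
  positivity

theorem measurable_picardKernel (ξ : E2) : Measurable (picardKernel ξ) := by
  unfold picardKernel
  fun_prop

/-- Two points near opposite large multiples of `e₁` have norms comparable to the multiple. -/
theorem picardKernel_bounds {M : ℝ} (hM : 4 ≤ M) {ξ η : E2}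
    (hη : ‖η - M • e1‖ ≤ 2) (hξ : ‖ξ - η + M • e1‖ ≤ 2) :
    1 / (1024 * M ^ 5) ≤ picardKernel ξ η ∧ picardKernel ξ η ≤ 256 / M ^ 5 := by
  have hM0 : 0 < M := by linarith
  have hn : ‖M • e1‖ = M := by
    rw [norm_smul, norm_e1, Real.norm_of_nonneg hM0.le, mul_one]
  have h0 : |η 0 - M| ≤ 2 := by
    have := (PiLp.norm_apply_le (η - M • e1) 0).trans hη
    simpa [e1] using this
  have hb : |‖η‖ - M| ≤ 2 := by
    have := (abs_norm_sub_norm_le η (M • e1)).trans hη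
    rwa [hn] at this
  have ha : |‖ξ - η‖ - M| ≤ 2 := by
    have := abs_norm_sub_norm_le (ξ - η) (-(M • e1))
    rw [norm_neg, hn, sub_neg_eq_add] at this
    exact this.trans hξ
  rw [abs_le] at h0 hb ha
  unfold picardKernel
  generalize ‖ξ - η‖ = a at *
  generalize ‖η‖ = b at *
  generalize η 0 = x at *
  have a1 : M / 2 ≤ a := by linarith
  have a2 : a ≤ 2 * M := by linarith
  have b1 : M / 2 ≤ b := by linarith
  have b2 : b ≤ 2 * M := by linarith
  have x1 : M / 2 ≤ x := by linarith
  have x2 : x ≤ 2 * M := by linarith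
  have a0 : 0 < a := by linarith
  have b0 : 0 < b := by linarith
  have x0 : 0 < x := by linarith
  constructor
  · calc 1 / (1024 * M ^ 5)
        ≤ (M / 2) ^ 2 / ((2 * M + 2 * M) * (2 * M) ^ 3 * (2 * M) ^ 3) := by
          apply le_of_eq
          field_simp
          norm_num
      _ ≤ x ^ 2 / ((a + b) * a ^ 3 * b ^ 3) := by gcongr
  · calc x ^ 2 / ((a + b) * a ^ 3 * b ^ 3)
        ≤ (2 * M) ^ 2 / ((M / 2 + M / 2) * (M / 2) ^ 3 * (M / 2) ^ 3) := by gcongr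
      _ = 256 / M ^ 5 := by
          field_simp
          norm_num

/-- Two-sided bound for the integral of the kernel against two bump functions localized near
opposite large multiples of `e₁`. -/
theorem integral_picardKernel_bounds {X : E2 → ℝ} (hXm : Measurable X)
    (h0 : ∀ ζ, 0 ≤ X ζ) (h1 : ∀ ζ, X ζ ≤ 1)
    (hin : ∀ ζ, ‖ζ‖ ≤ 1 → X ζ = 1) (hout : ∀ ζ, 2 ≤ ‖ζ‖ → X ζ = 0)
    {M : ℝ} (hM : 4 ≤ M) {ξ : E2} (hξ : ‖ξ‖ ≤ 1) :
    volume.real (Metric.closedBall (0 : E2) (1 / 2)) * (1 / (1024 * M ^ 5)) ≤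
        ∫ η, picardKernel ξ η * X (ξ - η + M • e1) * X (η - M • e1) ∧
      ∫ η, picardKernel ξ η * X (ξ - η + M • e1) * X (η - M • e1) ≤
        volume.real (Metric.closedBall (0 : E2) 2) * (256 / M ^ 5) := by
  set f : E2 → ℝ := fun η => picardKernel ξ η * X (ξ - η + M • e1) * X (η - M • e1) with hf
  have hM0 : 0 < M := by linarith
  have hf0 : ∀ η, 0 ≤ f η := fun η =>
    mul_nonneg (mul_nonneg (picardKernel_nonneg ξ η) (h0 _)) (h0 _)
  have hint : ∀ (x : E2) (r c : ℝ),
      Integrable ((Metric.closedBall x r).indicator fun _ : E2 => c) := fun x r c =>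
    (integrable_indicator_iff measurableSet_closedBall).2
      (integrableOn_const measure_closedBall_lt_top.ne)
  have hval : ∀ (x : E2) (r c : ℝ),
      ∫ η, (Metric.closedBall x r).indicator (fun _ : E2 => c) η =
        volume.real (Metric.closedBall (0 : E2) r) * c := fun x r c => by
    rw [integral_indicator_const _ measurableSet_closedBall, smul_eq_mul, Measure.real,
      Measure.real, Measure.addHaar_closedBall_center]
  have hfu : ∀ η, f η ≤ (Metric.closedBall (M • e1) 2).indicator (fun _ => 256 / M ^ 5) η := by
    intro η
    by_cases hη : ‖η - M • e1‖ ≤ 2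
    · rw [Set.indicator_of_mem (by rwa [Metric.mem_closedBall, dist_eq_norm])]
      by_cases hη' : ‖ξ - η + M • e1‖ ≤ 2
      · have hk := (picardKernel_bounds hM hη hη').2
        calc f η ≤ picardKernel ξ η * 1 * 1 := by
              have := picardKernel_nonneg ξ η
              have := h0 (ξ - η + M • e1)
              have := h0 (η - M • e1)
              simp only [hf]
              gcongr <;> apply h1
          _ ≤ 256 / M ^ 5 := by simpa using hk
      · simp only [hf, hout _ (not_le.1 hη').le, mul_zero, zero_mul]
        positivity
    · simp only [hf, hout _ (not_le.1 hη).le, mul_zero]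
      exact Set.indicator_nonneg (fun _ _ => by positivity) _
  have hfl : ∀ η, (Metric.closedBall (M • e1 + (1 / 2 : ℝ) • ξ) (1 / 2)).indicator
      (fun _ => 1 / (1024 * M ^ 5)) η ≤ f η := by
    intro η
    refine Set.indicator_le' (fun η hη => ?_) (fun η _ => hf0 η) η
    rw [Metric.mem_closedBall, dist_eq_norm] at hη
    have hs : ‖(1 / 2 : ℝ) • ξ‖ ≤ 1 / 2 := by
      rw [norm_smul, Real.norm_of_nonneg (by norm_num)]
      linarith
    have hη₁ : ‖η - M • e1‖ ≤ 1 := by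
      rw [show η - M • e1 = (η - (M • e1 + (1 / 2 : ℝ) • ξ)) + (1 / 2 : ℝ) • ξ by abel]
      exact (norm_add_le _ _).trans (by linarith)
    have hξ₁ : ‖ξ - η + M • e1‖ ≤ 1 := by
      rw [show ξ - η + M • e1 = (1 / 2 : ℝ) • ξ - (η - (M • e1 + (1 / 2 : ℝ) • ξ)) by module]
      exact (norm_sub_le _ _).trans (by linarith)
    simp only [hf, hin _ hη₁, hin _ hξ₁, mul_one]
    exact (picardKernel_bounds hM (by linarith) (by linarith)).1
  have hfm : Measurable f := by
    have := measurable_picardKernel ξ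
    fun_prop
  have hfi : Integrable f := by
    refine (hint (M • e1) 2 (256 / M ^ 5)).mono' hfm.aestronglyMeasurable
      (Filter.Eventually.of_forall fun η => ?_)
    rw [Real.norm_of_nonneg (hf0 η)]
    exact hfu η
  constructor
  · rw [← hval (M • e1 + (1 / 2 : ℝ) • ξ)]
    exact integral_mono (hint _ _ _) hfi hfl
  · rw [← hval (M • e1)]
    exact integral_mono hfi (hint _ _ _) hfu

/-- two-sided bound for the main term `I_N^{(1)}` of the second
Picard iterate. -/
theorem stmt8 (χ : SchwartzMap E2 ℝ) (X : E2 → ℝ)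
    (hX : ∀ ζ : E2, FT (fun x => ((χ x : ℝ) : ℂ)) ζ = ((X ζ : ℝ) : ℂ))
    (h0 : ∀ ζ : E2, 0 ≤ X ζ) (h1 : ∀ ζ : E2, X ζ ≤ 1)
    (hin : ∀ ζ : E2, ‖ζ‖ ≤ 1 → X ζ = 1)
    (hout : ∀ ζ : E2, 2 ≤ ‖ζ‖ → X ζ = 0) :
    ∃ c C : ℝ, 0 < c ∧ c < C ∧
      ∀ N : ℕ, 100 ≤ N → ∀ ξ : E2, 0 < ‖ξ‖ → ‖ξ‖ ≤ 1 →
        ‖ξ‖ / 4 ≤ ξ 0 → ‖ξ‖ / 4 ≤ ξ 1 →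
        c ≤ (2 : ℝ) ^ (5 * N) * (ξ 0 * ξ 1 / ‖ξ‖ ^ 2) *
            ∫ η : E2, (η 0) ^ 2 / ((‖ξ - η‖ + ‖η‖) * ‖ξ - η‖ ^ 3 * ‖η‖ ^ 3) *
              X (ξ - η + ((2 : ℝ) ^ N) • e1) * X (η - ((2 : ℝ) ^ N) • e1) ∧
        (2 : ℝ) ^ (5 * N) * (ξ 0 * ξ 1 / ‖ξ‖ ^ 2) *
            (∫ η : E2, (η 0) ^ 2 / ((‖ξ - η‖ + ‖η‖) * ‖ξ - η‖ ^ 3 * ‖η‖ ^ 3) *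
              X (ξ - η + ((2 : ℝ) ^ N) • e1) * X (η - ((2 : ℝ) ^ N) • e1)) ≤ C := by
  have hXc : Continuous X := by
    have hF : Continuous fun ζ => (FT (fun x => ((χ x : ℝ) : ℂ)) ζ).re :=
      Complex.continuous_re.comp (continuous_FT χ.integrable.ofReal)
    simpa only [hX, Complex.ofReal_re] using hF
  set v₁ := volume.real (Metric.closedBall (0 : E2) (1 / 2)) with hv₁
  set v₂ := volume.real (Metric.closedBall (0 : E2) 2) with hv₂
  have hv₁0 : 0 < v₁ :=
    ENNReal.toReal_pos (Metric.measure_closedBall_pos volume _ (by norm_num)).ne'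
      measure_closedBall_lt_top.ne
  have hv₂0 : 0 < v₂ :=
    ENNReal.toReal_pos (Metric.measure_closedBall_pos volume _ (by norm_num)).ne'
      measure_closedBall_lt_top.ne
  refine ⟨v₁ / 16384, v₁ / 16384 + 256 * v₂, by positivity, by linarith, ?_⟩
  intro N hN ξ hξ0 hξ1 hx hy
  have hM : (4 : ℝ) ≤ 2 ^ N := by
    calc (4 : ℝ) = 2 ^ 2 := by norm_num
      _ ≤ 2 ^ N := pow_le_pow_right₀ (by norm_num) (by omega)
  obtain ⟨hl, hu⟩ := integral_picardKernel_bounds hXc.measurable h0 h1 hin hout hM hξ1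
  simp only [picardKernel] at hl hu
  rw [← hv₁] at hl
  rw [← hv₂] at hu
  rw [mul_comm 5 N, pow_mul]
  generalize (2 : ℝ) ^ N = M at *
  generalize (∫ η : E2, (η 0) ^ 2 / ((‖ξ - η‖ + ‖η‖) * ‖ξ - η‖ ^ 3 * ‖η‖ ^ 3) *
    X (ξ - η + M • e1) * X (η - M • e1)) = J at *
  have hM0 : 0 < M := by linarith
  have hr1 : 1 / 16 ≤ ξ 0 * ξ 1 / ‖ξ‖ ^ 2 := by
    rw [le_div_iff₀ (by positivity)]
    nlinarith [mul_le_mul hx hy (by positivity) (by linarith)]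
  have hr2 : ξ 0 * ξ 1 / ‖ξ‖ ^ 2 ≤ 1 := by
    rw [div_le_one (by positivity), EuclideanSpace.real_norm_sq_eq, Fin.sum_univ_two]
    nlinarith [sq_nonneg (ξ 0 - ξ 1), sq_nonneg (ξ 0 + ξ 1)]
  generalize ξ 0 * ξ 1 / ‖ξ‖ ^ 2 = r at *
  have hl' : v₁ / 1024 ≤ M ^ 5 * J := by
    calc v₁ / 1024 = M ^ 5 * (v₁ * (1 / (1024 * M ^ 5))) := by field_simp
      _ ≤ M ^ 5 * J := by gcongr
  have hu' : M ^ 5 * J ≤ 256 * v₂ := by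
    calc M ^ 5 * J ≤ M ^ 5 * (v₂ * (256 / M ^ 5)) := by gcongr
      _ = 256 * v₂ := by field_simp
  rw [mul_right_comm]
  constructor
  · calc v₁ / 16384 = v₁ / 1024 * (1 / 16) := by ring
      _ ≤ M ^ 5 * J * r := by gcongr; linarith
  · calc M ^ 5 * J * r ≤ M ^ 5 * J * 1 := by
          have : 0 ≤ M ^ 5 * J := le_trans (by positivity) hl'
          gcongr
      _ ≤ v₁ / 16384 + 256 * v₂ := by linarith
end
end

section
/- Let χ : ℝ² → ℝ be a Schwartz function whose Fourier transform satisfies 0 ≤ χ̂ ≤ 1 everywhere and χ̂(ζ) = 0 for ‖ζ‖ ≥ 2. There exists an absolute constant C > 0 such that for every integer N ≥ 100 and every ξ = (ξ₁, ξ₂) ∈ ℝ² with 0 < ‖ξ‖ ≤ 1, | (2^{5N}/‖ξ‖²) ∫_{ℝ²} ((ξ₂² − ξ₁²) η₁ η₂ − ξ₁ ξ₂ η₂²) / ((‖ξ−η‖ + ‖η‖) ‖ξ−η‖³ ‖η‖³) · χ̂(ξ − η + 2^N e₁) · χ̂(η − 2^N e₁) dη | ≤ C · 2^{−N}. -/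
open MeasureTheory Complex
open scoped RealInnerProductSpace ENNReal NNReal

noncomputable section

/-- Pointwise bound for the symbol of the bilinear operator at high frequency `M`, for `η` within
distance `2` of `M e₁`. -/
lemma abs_symbol_le {M : ℝ} (hM : 100 ≤ M) {ξ η : E2} (hξ : ‖ξ‖ ≤ 1) (hη : ‖η - M • e1‖ ≤ 2) :
    |(((ξ 1) ^ 2 - (ξ 0) ^ 2) * η 0 * η 1 - ξ 0 * ξ 1 * (η 1) ^ 2) /
        ((‖ξ - η‖ + ‖η‖) * ‖ξ - η‖ ^ 3 * ‖η‖ ^ 3)| ≤ 320 * ‖ξ‖ ^ 2 * (M ^ 6)⁻¹ := by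
  have hMpos : 0 < M := by linarith
  have hMe : ‖M • e1‖ = M := by
    simp [e1, norm_smul, abs_of_pos hMpos]
  have hη_low : M / 2 ≤ ‖η‖ := by
    have := norm_sub_norm_le (M • e1) η
    rw [norm_sub_rev, hMe] at this
    linarith
  have hη_up : ‖η‖ ≤ 2 * M := by
    have := norm_sub_norm_le η (M • e1)
    rw [hMe] at this
    linarith
  have hξη_low : M / 2 ≤ ‖ξ - η‖ := by
    have h₁ := norm_sub_norm_le (M • e1) η
    have h₂ := norm_sub_norm_le η ξ
    rw [norm_sub_rev, hMe] at h₁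
    rw [norm_sub_rev] at h₂
    linarith
  have hη0 : |η 0| ≤ 2 * M := (PiLp.norm_apply_le η 0).trans hη_up
  have hη1 : |η 1| ≤ 2 := by
    have := (PiLp.norm_apply_le (η - M • e1) 1).trans hη
    simpa [e1] using this
  have hsq : ‖ξ‖ ^ 2 = ξ 0 ^ 2 + ξ 1 ^ 2 := by
    simp [EuclideanSpace.norm_sq_eq, Fin.sum_univ_two]
  have hdiff : |ξ 1 ^ 2 - ξ 0 ^ 2| ≤ ‖ξ‖ ^ 2 := by
    rw [hsq, abs_le]; constructor <;> nlinarith [sq_nonneg (ξ 0), sq_nonneg (ξ 1)]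
  have hprod : |ξ 0 * ξ 1| ≤ ‖ξ‖ ^ 2 := by
    rw [hsq, abs_le]
    constructor <;> nlinarith [sq_nonneg (ξ 0 + ξ 1), sq_nonneg (ξ 0 - ξ 1)]
  have hnum : |((ξ 1) ^ 2 - (ξ 0) ^ 2) * η 0 * η 1 - ξ 0 * ξ 1 * (η 1) ^ 2| ≤
      ‖ξ‖ ^ 2 * (5 * M) := by
    calc _ ≤ |((ξ 1) ^ 2 - (ξ 0) ^ 2) * η 0 * η 1| + |ξ 0 * ξ 1 * (η 1) ^ 2| := abs_sub _ _
      _ = |(ξ 1) ^ 2 - (ξ 0) ^ 2| * |η 0| * |η 1| + |ξ 0 * ξ 1| * |η 1| ^ 2 := by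
        rw [abs_mul, abs_mul, abs_mul (ξ 0 * ξ 1), abs_pow]
      _ ≤ ‖ξ‖ ^ 2 * (2 * M) * 2 + ‖ξ‖ ^ 2 * 2 ^ 2 := by gcongr
      _ ≤ ‖ξ‖ ^ 2 * (5 * M) := by nlinarith [sq_nonneg ‖ξ‖]
  have hden : M ^ 7 / 64 ≤ (‖ξ - η‖ + ‖η‖) * ‖ξ - η‖ ^ 3 * ‖η‖ ^ 3 := by
    calc M ^ 7 / 64 = (M / 2 + M / 2) * (M / 2) ^ 3 * (M / 2) ^ 3 := by ring
      _ ≤ _ := by gcongr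
  rw [abs_div, abs_of_nonneg (by positivity : 0 ≤ (‖ξ - η‖ + ‖η‖) * ‖ξ - η‖ ^ 3 * ‖η‖ ^ 3)]
  calc _ ≤ ‖ξ‖ ^ 2 * (5 * M) / (M ^ 7 / 64) := by gcongr
    _ = 320 * ‖ξ‖ ^ 2 * (M ^ 6)⁻¹ := by field_simp; ring

/-- bound for the error term `I_N^{(2)}` of the second Picard iterate. -/
theorem stmt9 (χ : SchwartzMap E2 ℝ) (X : E2 → ℝ)
    (hX : ∀ ζ : E2, FT (fun x => ((χ x : ℝ) : ℂ)) ζ = ((X ζ : ℝ) : ℂ))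
    (h0 : ∀ ζ : E2, 0 ≤ X ζ) (h1 : ∀ ζ : E2, X ζ ≤ 1)
    (hout : ∀ ζ : E2, 2 ≤ ‖ζ‖ → X ζ = 0) :
    ∃ C : ℝ, 0 < C ∧
      ∀ N : ℕ, 100 ≤ N → ∀ ξ : E2, 0 < ‖ξ‖ → ‖ξ‖ ≤ 1 →
        |(2 : ℝ) ^ (5 * N) / ‖ξ‖ ^ 2 *
            ∫ η : E2, (((ξ 1) ^ 2 - (ξ 0) ^ 2) * η 0 * η 1 - ξ 0 * ξ 1 * (η 1) ^ 2) /
                ((‖ξ - η‖ + ‖η‖) * ‖ξ - η‖ ^ 3 * ‖η‖ ^ 3) *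
              X (ξ - η + ((2 : ℝ) ^ N) • e1) * X (η - ((2 : ℝ) ^ N) • e1)| ≤
          C * ((2 : ℝ) ^ N)⁻¹ := by
  have hXabs (ζ : E2) : |X ζ| ≤ 1 := by rw [abs_of_nonneg (h0 ζ)]; exact h1 ζ
  set V : ℝ := volume.real (Metric.closedBall (0 : E2) 2) with hV
  have hV0 : 0 ≤ V := measureReal_nonneg
  refine ⟨320 * V + 1, by positivity, fun N hN ξ hξ0 hξ => ?_⟩
  have hM : (100 : ℝ) ≤ 2 ^ N := by
    calc (100 : ℝ) ≤ 2 ^ 7 := by norm_num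
      _ ≤ 2 ^ N := pow_le_pow_right₀ (by norm_num) (by omega)
  rw [mul_comm 5 N, pow_mul]
  generalize (2 : ℝ) ^ N = M at hM ⊢
  have hMpos : 0 < M := by linarith
  set s := Metric.closedBall (M • e1) 2 with hs
  have hvol : volume.real s = V := by
    rw [hs, hV, measureReal_def, measureReal_def, Measure.addHaar_closedBall_center]
  rw [← setIntegral_eq_integral_of_forall_compl_eq_zero (s := s), abs_mul]
  · have hint := norm_setIntegral_le_of_norm_le_const (μ := volume) (s := s)
      (C := 320 * ‖ξ‖ ^ 2 * (M ^ 6)⁻¹)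
      (f := fun η : E2 => (((ξ 1) ^ 2 - (ξ 0) ^ 2) * η 0 * η 1 - ξ 0 * ξ 1 * (η 1) ^ 2) /
                ((‖ξ - η‖ + ‖η‖) * ‖ξ - η‖ ^ 3 * ‖η‖ ^ 3) *
              X (ξ - η + M • e1) * X (η - M • e1))
      measure_closedBall_lt_top (fun η hη => by
        rw [hs, mem_closedBall_iff_norm] at hη
        rw [Real.norm_eq_abs, abs_mul, abs_mul]
        calc _ ≤ 320 * ‖ξ‖ ^ 2 * (M ^ 6)⁻¹ * 1 * 1 := by
              gcongr
              · exact abs_symbol_le hM hξ hη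
              · exact hXabs _
              · exact hXabs _
          _ = _ := by ring)
    rw [hvol, Real.norm_eq_abs] at hint
    rw [abs_of_nonneg (by positivity : 0 ≤ M ^ 5 / ‖ξ‖ ^ 2)]
    calc _ ≤ M ^ 5 / ‖ξ‖ ^ 2 * (320 * ‖ξ‖ ^ 2 * (M ^ 6)⁻¹ * V) := by gcongr
      _ = 320 * V * M⁻¹ := by field_simp
      _ ≤ (320 * V + 1) * M⁻¹ := by gcongr; linarith
  · intro η hη
    rw [hs, mem_closedBall_iff_norm, not_le] at hη
    rw [hout _ hη.le, mul_zero]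
end
end

section
/- Let χ : ℝ² → ℝ be a Schwartz function whose Fourier transform satisfies 0 ≤ χ̂ ≤ 1 everywhere and χ̂(ζ) = 0 for ‖ζ‖ ≥ 2. There exists an absolute constant C > 0 such that for every integer N ≥ 100 and every ξ ∈ ℝ² with ‖ξ‖ ≤ 1, | 2^{5N} ∫_{ℝ²} (ξ·η^⊥) / ((‖ξ−η‖ + ‖η‖) ‖ξ−η‖³ ‖η‖³) · χ̂(ξ − η + 2^N e₁) · χ̂(η − 2^N e₁) dη | ≤ C · 2^{−N}. -/
open MeasureTheory Complex
open scoped RealInnerProductSpace ENNReal NNReal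

noncomputable section

theorem norm_perp (η : E2) : ‖perp η‖ = ‖η‖ := by
  simp [perp, EuclideanSpace.norm_eq, Fin.sum_univ_two, add_comm]

theorem abs_kernel_le {L : ℝ} (hL : 100 ≤ L) {ξ η : E2} (hξ : ‖ξ‖ ≤ 1)
    (hη : ‖η - L • e1‖ ≤ 2) :
    |⟪ξ, perp η⟫ / ((‖ξ - η‖ + ‖η‖) * ‖ξ - η‖ ^ 3 * ‖η‖ ^ 3)| ≤ 64 / L ^ 6 := by
  have hLe : ‖L • e1‖ = L := by rw [norm_smul, norm_e1, mul_one, Real.norm_of_nonneg (by linarith)]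
  have hlow : L / 2 ≤ ‖η‖ := by
    have h := norm_sub_norm_le (L • e1) (L • e1 - η)
    rw [sub_sub_cancel, norm_sub_rev, hLe] at h
    linarith
  have hlow' : L / 2 ≤ ‖ξ - η‖ := by
    have h := norm_sub_norm_le (L • e1) (L • e1 - η)
    rw [sub_sub_cancel, norm_sub_rev, hLe] at h
    have h' := norm_sub_norm_le η ξ
    rw [norm_sub_rev] at h'
    linarith
  have hin : |⟪ξ, perp η⟫| ≤ ‖η‖ := by
    calc |⟪ξ, perp η⟫| ≤ ‖ξ‖ * ‖perp η‖ := abs_real_inner_le_norm _ _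
      _ ≤ 1 * ‖η‖ := by rw [norm_perp]; gcongr
      _ = ‖η‖ := one_mul _
  have hη0 : 0 < ‖η‖ := by linarith
  have hξη0 : 0 < ‖ξ - η‖ := by linarith
  have hL0 : 0 < L := by linarith
  rw [abs_div, abs_of_pos (by positivity : 0 < (‖ξ - η‖ + ‖η‖) * ‖ξ - η‖ ^ 3 * ‖η‖ ^ 3)]
  calc _ ≤ ‖η‖ / (‖η‖ * (L / 2) ^ 3 * (L / 2) ^ 3) := by
        gcongr
        linarith
    _ = 64 / L ^ 6 := by field_simp; norm_num

/-- bound for the error term `I_N^{(3)}` of the second Picard iterate. -/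
theorem stmt10 (χ : SchwartzMap E2 ℝ) (X : E2 → ℝ)
    (hX : ∀ ζ : E2, FT (fun x => ((χ x : ℝ) : ℂ)) ζ = ((X ζ : ℝ) : ℂ))
    (h0 : ∀ ζ : E2, 0 ≤ X ζ) (h1 : ∀ ζ : E2, X ζ ≤ 1)
    (hout : ∀ ζ : E2, 2 ≤ ‖ζ‖ → X ζ = 0) :
    ∃ C : ℝ, 0 < C ∧
      ∀ N : ℕ, 100 ≤ N → ∀ ξ : E2, ‖ξ‖ ≤ 1 →
        |(2 : ℝ) ^ (5 * N) *
            ∫ η : E2, ⟪ξ, perp η⟫ / ((‖ξ - η‖ + ‖η‖) * ‖ξ - η‖ ^ 3 * ‖η‖ ^ 3) *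
              X (ξ - η + ((2 : ℝ) ^ N) • e1) * X (η - ((2 : ℝ) ^ N) • e1)| ≤
          C * ((2 : ℝ) ^ N)⁻¹ := by
  set V : ℝ := volume.real (Metric.closedBall (0 : E2) 2) with hV
  have hV0 : 0 ≤ V := measureReal_nonneg
  refine ⟨64 * V + 1, by positivity, fun N hN ξ hξ => ?_⟩
  have hL : (100 : ℝ) ≤ 2 ^ N := by
    have h : N < 2 ^ N := Nat.lt_two_pow_self
    exact_mod_cast hN.trans h.le
  rw [mul_comm 5 N, pow_mul]
  generalize (2 : ℝ) ^ N = L at hL ⊢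
  have hL0 : 0 < L := by linarith
  have hball : volume.real (Metric.closedBall (L • e1) 2) = V := by
    rw [hV, measureReal_def, measureReal_def, Measure.addHaar_closedBall_center]
  rw [← setIntegral_eq_integral_of_forall_compl_eq_zero (s := Metric.closedBall (L • e1) 2)]
  · have hI := norm_setIntegral_le_of_norm_le_const (μ := volume)
      (s := Metric.closedBall (L • e1) 2) (C := 64 / L ^ 6)
      (f := fun η : E2 => ⟪ξ, perp η⟫ / ((‖ξ - η‖ + ‖η‖) * ‖ξ - η‖ ^ 3 * ‖η‖ ^ 3) *
        X (ξ - η + L • e1) * X (η - L • e1)) measure_closedBall_lt_top (fun η hη => by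
        rw [mem_closedBall_iff_norm] at hη
        rw [norm_mul, norm_mul, Real.norm_eq_abs, Real.norm_of_nonneg (h0 _),
          Real.norm_of_nonneg (h0 _)]
        calc _ ≤ 64 / L ^ 6 * 1 * 1 := by
              gcongr
              · exact h0 _
              · exact h0 _
              · exact abs_kernel_le hL hξ hη
              · exact h1 _
              · exact h1 _
          _ = 64 / L ^ 6 := by ring)
    rw [hball, Real.norm_eq_abs] at hI
    rw [abs_mul, abs_of_pos (by positivity : 0 < L ^ 5)]
    calc _ ≤ L ^ 5 * (64 / L ^ 6 * V) := by gcongr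
      _ = 64 * V * L⁻¹ := by field_simp
      _ ≤ (64 * V + 1) * L⁻¹ := by gcongr; linarith
  · intro η hη
    rw [mem_closedBall_iff_norm, not_le] at hη
    rw [hout _ hη.le, mul_zero]
end
end

section
/- Let χ : ℝ² → ℝ be a Schwartz function whose Fourier transform satisfies 0 ≤ χ̂ ≤ 1 everywhere, χ̂(ζ) = 1 for ‖ζ‖ ≤ 1, and χ̂(ζ) = 0 for ‖ζ‖ ≥ 2, and let φ₀ be a dyadic partition function. For an integer N ≥ 100 and δ > 0, define for ξ ≠ 0: B̂_N(ξ) := (δ² 2^{5N}/8) ∫_{ℝ²} (ξ·η^⊥)(ξ·(2η−ξ)) / (‖ξ‖² (‖η‖+‖ξ−η‖) ‖ξ−η‖³ ‖η‖³) · (χ̂(ξ−η+2^N e₁) + χ̂(ξ−η−2^N e₁)) · (χ̂(η+2^N e₁) + χ̂(η−2^N e₁)) dη. Then there exist a constant c > 0 and an integer N₀ ≥ 100, both depending only on χ and φ₀, such that for every integer N ≥ N₀, every δ > 0, and every integer j ≤ −1, sup_{x ∈ ℝ²} | (2π)^{−2} ∫_{ℝ²} e^{i x·ξ} φ̂₀(2^{−j}ξ)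 B̂_N(ξ) dξ | ≥ c δ² 2^{2j}. -/
open MeasureTheory Complex
open scoped RealInnerProductSpace ENNReal NNReal

noncomputable section

/-- The Fourier transform `B̂_N` of the second Picard iterate associated with the
force `f_N(x) = δ 2^{5N/2} χ(x) cos(2^N x₁)`, where `X = χ̂`. -/
def BNhat (X : E2 → ℝ) (N : ℕ) (δ : ℝ) (ξ : E2) : ℝ :=
  δ ^ 2 * (2 : ℝ) ^ (5 * N) / 8 *
    ∫ η : E2, ⟪ξ, perp η⟫ * ⟪ξ, (2 : ℝ) • η - ξ⟫ /
        (‖ξ‖ ^ 2 * (‖η‖ + ‖ξ - η‖) * ‖ξ - η‖ ^ 3 * ‖η‖ ^ 3) *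
      (X (ξ - η + ((2 : ℝ) ^ N) • e1) + X (ξ - η - ((2 : ℝ) ^ N) • e1)) *
      (X (η + ((2 : ℝ) ^ N) • e1) + X (η - ((2 : ℝ) ^ N) • e1))

theorem measurable_FT {h : E2 → ℂ} (hh : Measurable h) : Measurable (FT h) := by
  have : StronglyMeasurable (fun p : E2 × E2 =>
      Complex.exp (-(Complex.I * ((⟪p.2, p.1⟫ : ℝ) : ℂ))) * h p.2) := by
    apply Measurable.stronglyMeasurable
    fun_prop
  exact this.integral_prod_right.measurable

theorem measurable_of_FT_eq {h : E2 → ℂ} (hh : Measurable h) {Y : E2 → ℝ}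
    (hY : ∀ ζ, FT h ζ = ((Y ζ : ℝ) : ℂ)) : Measurable Y := by
  have : Y = fun ζ => (FT h ζ).re := by
    ext ζ; simp [hY]
  rw [this]
  exact Complex.measurable_re.comp (measurable_FT hh)

theorem inner_perp (ξ η : E2) : ⟪ξ, perp η⟫ = ξ 1 * η 0 - ξ 0 * η 1 := by
  simp [perp, PiLp.inner_apply, Fin.sum_univ_two]
  ring

theorem inner_eq_coord (ξ η : E2) : ⟪ξ, η⟫ = ξ 0 * η 0 + ξ 1 * η 1 := by
  simp [PiLp.inner_apply, Fin.sum_univ_two]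
  ring

theorem norm_sq_eq_coord (ξ : E2) : ‖ξ‖ ^ 2 = ξ 0 ^ 2 + ξ 1 ^ 2 := by
  simp [EuclideanSpace.real_norm_sq_eq, Fin.sum_univ_two]

theorem abs_coord_le (ξ : E2) (i : Fin 2) : |ξ i| ≤ ‖ξ‖ := by
  simpa using PiLp.norm_apply_le ξ i

/-- The numerator of the bilinear symbol is `2 M² ξ₁ ξ₂` up to `O(M ‖ξ‖²)` for `η` near
`σ M e₁`, `σ = ±1`. -/
theorem abs_numerator_sub_le {ξ η : E2} {M σ : ℝ} (hM : 100 ≤ M) (hσ : |σ| = 1)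
    (hξ : ‖ξ‖ ≤ 1) (hη : ‖η - (σ * M) • e1‖ ≤ 2) :
    |⟪ξ, perp η⟫ * ⟪ξ, (2 : ℝ) • η - ξ⟫ - 2 * M ^ 2 * (ξ 0 * ξ 1)| ≤ 10 * M * ‖ξ‖ ^ 2 := by
  set ζ := η - (σ * M) • e1 with hζ
  have hη' : η = (σ * M) • e1 + ζ := by rw [hζ]; abel
  have hs : σ ^ 2 = 1 := by rw [← sq_abs, hσ]; norm_num
  have ha : |⟪ξ, perp ζ⟫| ≤ ‖ξ‖ * 2 := by
    refine (abs_real_inner_le_norm _ _).trans ?_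
    rw [norm_perp]; gcongr
  have hb : |⟪ξ, (2 : ℝ) • ζ - ξ⟫| ≤ ‖ξ‖ * 5 := by
    refine (abs_real_inner_le_norm _ _).trans ?_
    gcongr
    refine (norm_sub_le _ _).trans ?_
    rw [norm_smul]; norm_num; linarith
  have e : ⟪ξ, perp η⟫ * ⟪ξ, (2 : ℝ) • η - ξ⟫ - 2 * M ^ 2 * (ξ 0 * ξ 1)
      = σ * (M * (ξ 1 * ⟪ξ, (2 : ℝ) • ζ - ξ⟫)) + σ * (2 * (M * (ξ 0 * ⟪ξ, perp ζ⟫)))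
        + ⟪ξ, perp ζ⟫ * ⟪ξ, (2 : ℝ) • ζ - ξ⟫ := by
    rw [hη']
    simp only [inner_perp]
    simp only [inner_eq_coord]
    simp [e1]
    linear_combination (2 * M ^ 2 * ξ 0 * ξ 1) * hs
  rw [e]
  have h1 := abs_coord_le ξ 1
  have h0 := abs_coord_le ξ 0
  have hM0 : |M| = M := abs_of_nonneg (by linarith)
  have t1 : |σ * (M * (ξ 1 * ⟪ξ, (2 : ℝ) • ζ - ξ⟫))| ≤ M * (‖ξ‖ * (‖ξ‖ * 5)) := by
    rw [abs_mul, abs_mul, abs_mul, hσ, one_mul, hM0]; gcongr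
  have t2 : |σ * (2 * (M * (ξ 0 * ⟪ξ, perp ζ⟫)))| ≤ 2 * (M * (‖ξ‖ * (‖ξ‖ * 2))) := by
    rw [abs_mul, abs_mul, abs_mul, abs_mul, hσ, one_mul, hM0, abs_two]; gcongr
  have t3 : |⟪ξ, perp ζ⟫ * ⟪ξ, (2 : ℝ) • ζ - ξ⟫| ≤ ‖ξ‖ * 2 * (‖ξ‖ * 5) := by
    rw [abs_mul]; gcongr
  refine (abs_add_three _ _ _).trans ?_
  nlinarith [sq_nonneg ‖ξ‖]

theorem denominator_bounds {ξ η : E2} {M σ : ℝ} (hM : 100 ≤ M) (hσ : |σ| = 1)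
    (hξ : ‖ξ‖ ≤ 1) (hη : ‖η - (σ * M) • e1‖ ≤ 2) :
    M ^ 7 / 64 ≤ (‖η‖ + ‖ξ - η‖) * ‖ξ - η‖ ^ 3 * ‖η‖ ^ 3 ∧
      (‖η‖ + ‖ξ - η‖) * ‖ξ - η‖ ^ 3 * ‖η‖ ^ 3 ≤ 256 * M ^ 7 := by
  have hn : ‖(σ * M) • e1‖ = M := by
    rw [norm_smul, norm_e1, Real.norm_eq_abs, abs_mul, hσ, abs_of_nonneg (by linarith)]; ring
  have h1 := abs_le.1 (abs_norm_sub_norm_le η ((σ * M) • e1))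
  have h2 := abs_le.1 (abs_norm_sub_norm_le η ξ)
  rw [norm_sub_rev η ξ] at h2
  have h3 : ‖ξ - η‖ ≤ ‖ξ‖ + ‖η‖ := norm_sub_le _ _
  rw [hn] at h1
  have a1 : M / 2 ≤ ‖η‖ := by linarith
  have a2 : ‖η‖ ≤ 2 * M := by linarith
  have b1 : M / 2 ≤ ‖ξ - η‖ := by linarith
  have b2 : ‖ξ - η‖ ≤ 2 * M := by linarith
  have hM0 : 0 ≤ M := by linarith
  constructor
  · calc M ^ 7 / 64 = (M / 2 + M / 2) * (M / 2) ^ 3 * (M / 2) ^ 3 := by ring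
      _ ≤ _ := by gcongr
  · calc _ ≤ (2 * M + 2 * M) * (2 * M) ^ 3 * (2 * M) ^ 3 := by gcongr
      _ = 256 * M ^ 7 := by ring

/-- The symbol of the bilinear operator defining `BNhat`. -/
def bilinSymbol (ξ η : E2) : ℝ :=
  ⟪ξ, perp η⟫ * ⟪ξ, (2 : ℝ) • η - ξ⟫ /
    (‖ξ‖ ^ 2 * (‖η‖ + ‖ξ - η‖) * ‖ξ - η‖ ^ 3 * ‖η‖ ^ 3)

theorem abs_bilinSymbol_le {ξ η : E2} {M σ : ℝ} (hM : 100 ≤ M) (hσ : |σ| = 1)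
    (hξ0 : 0 < ‖ξ‖) (hξ : ‖ξ‖ ≤ 1) (hη : ‖η - (σ * M) • e1‖ ≤ 2) :
    |M ^ 5 * bilinSymbol ξ η| ≤ 200 := by
  have hP := abs_numerator_sub_le hM hσ hξ hη
  obtain ⟨hQ, -⟩ := denominator_bounds hM hσ hξ hη
  unfold bilinSymbol
  set P := ⟪ξ, perp η⟫ * ⟪ξ, (2 : ℝ) • η - ξ⟫
  rw [show ‖ξ‖ ^ 2 * (‖η‖ + ‖ξ - η‖) * ‖ξ - η‖ ^ 3 * ‖η‖ ^ 3
    = ‖ξ‖ ^ 2 * ((‖η‖ + ‖ξ - η‖) * ‖ξ - η‖ ^ 3 * ‖η‖ ^ 3) by ring]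
  set Q := (‖η‖ + ‖ξ - η‖) * ‖ξ - η‖ ^ 3 * ‖η‖ ^ 3
  have hM0 : 0 < M := by linarith
  have hQ0 : 0 < Q := lt_of_lt_of_le (by positivity) hQ
  have hP2 : |P| ≤ 3 * M ^ 2 * ‖ξ‖ ^ 2 := by
    have h01 : |2 * M ^ 2 * (ξ 0 * ξ 1)| ≤ M ^ 2 * ‖ξ‖ ^ 2 := by
      rw [abs_mul, abs_of_nonneg (by positivity : 0 ≤ 2 * M ^ 2), mul_comm 2, mul_assoc]
      gcongr
      rw [norm_sq_eq_coord, abs_mul]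
      nlinarith [sq_nonneg (|ξ 0| - |ξ 1|), sq_abs (ξ 0), sq_abs (ξ 1)]
    have h3 : 10 * M * ‖ξ‖ ^ 2 ≤ M ^ 2 * ‖ξ‖ ^ 2 := by
      gcongr; nlinarith
    have := abs_add_le (P - 2 * M ^ 2 * (ξ 0 * ξ 1)) (2 * M ^ 2 * (ξ 0 * ξ 1))
    rw [sub_add_cancel] at this
    nlinarith [mul_pos (pow_pos hM0 2) (pow_pos hξ0 2)]
  rw [abs_mul, abs_div, abs_of_pos (pow_pos hM0 5), abs_of_pos (by positivity : 0 < ‖ξ‖ ^ 2 * Q),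
    ← mul_div_assoc, div_le_iff₀ (by positivity)]
  calc M ^ 5 * |P| ≤ M ^ 5 * (3 * M ^ 2 * ‖ξ‖ ^ 2) := by gcongr
    _ = 192 * (‖ξ‖ ^ 2 * (M ^ 7 / 64)) := by ring
    _ ≤ 192 * (‖ξ‖ ^ 2 * Q) := by gcongr
    _ ≤ 200 * (‖ξ‖ ^ 2 * Q) := by gcongr; norm_num

theorem le_mul_bilinSymbol {ξ η : E2} {M σ p : ℝ} (hM : 100 ≤ M) (hσ : |σ| = 1)
    (hξ0 : 0 < ‖ξ‖) (hξ : ‖ξ‖ ≤ 1) (hη : ‖η - (σ * M) • e1‖ ≤ 2)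
    (hp : |p| ≤ 1) (hp0 : 0 ≤ p * (ξ 0 * ξ 1)) :
    p * (ξ 0 * ξ 1) / (128 * ‖ξ‖ ^ 2) - 640 / M ≤ p * (M ^ 5 * bilinSymbol ξ η) := by
  have hP := abs_numerator_sub_le hM hσ hξ hη
  obtain ⟨hQ, hQ'⟩ := denominator_bounds hM hσ hξ hη
  unfold bilinSymbol
  set P := ⟪ξ, perp η⟫ * ⟪ξ, (2 : ℝ) • η - ξ⟫
  rw [show ‖ξ‖ ^ 2 * (‖η‖ + ‖ξ - η‖) * ‖ξ - η‖ ^ 3 * ‖η‖ ^ 3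
    = ‖ξ‖ ^ 2 * ((‖η‖ + ‖ξ - η‖) * ‖ξ - η‖ ^ 3 * ‖η‖ ^ 3) by ring]
  set Q := (‖η‖ + ‖ξ - η‖) * ‖ξ - η‖ ^ 3 * ‖η‖ ^ 3
  have hM0 : 0 < M := by linarith
  have hQ0 : 0 < Q := lt_of_lt_of_le (by positivity) hQ
  set E := P - 2 * M ^ 2 * (ξ 0 * ξ 1) with hE
  have hPE : P = 2 * M ^ 2 * (ξ 0 * ξ 1) + E := by rw [hE]; ring
  have hpE : -(10 * M * ‖ξ‖ ^ 2) ≤ p * E := by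
    have : |p * E| ≤ 1 * (10 * M * ‖ξ‖ ^ 2) := by rw [abs_mul]; gcongr
    linarith [(abs_le.1 this).1]
  have e : p * (M ^ 5 * (P / (‖ξ‖ ^ 2 * Q)))
      = 2 * M ^ 7 * (p * (ξ 0 * ξ 1)) / (‖ξ‖ ^ 2 * Q) + M ^ 5 * (p * E) / (‖ξ‖ ^ 2 * Q) := by
    rw [hPE]; ring
  rw [e]
  have t1 : p * (ξ 0 * ξ 1) / (128 * ‖ξ‖ ^ 2)
      ≤ 2 * M ^ 7 * (p * (ξ 0 * ξ 1)) / (‖ξ‖ ^ 2 * Q) := by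
    rw [div_le_div_iff₀ (by positivity) (by positivity)]
    calc p * (ξ 0 * ξ 1) * (‖ξ‖ ^ 2 * Q) ≤ p * (ξ 0 * ξ 1) * (‖ξ‖ ^ 2 * (256 * M ^ 7)) := by
          gcongr
      _ = _ := by ring
  have t2 : -(640 / M) ≤ M ^ 5 * (p * E) / (‖ξ‖ ^ 2 * Q) := by
    rw [← neg_div, div_le_div_iff₀ hM0 (by positivity)]
    calc -640 * (‖ξ‖ ^ 2 * Q) ≤ -640 * (‖ξ‖ ^ 2 * (M ^ 7 / 64)) := by
          have : ‖ξ‖ ^ 2 * (M ^ 7 / 64) ≤ ‖ξ‖ ^ 2 * Q := by gcongr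
          linarith
      _ = M ^ 5 * (-(10 * M * ‖ξ‖ ^ 2)) * M := by ring
      _ ≤ M ^ 5 * (p * E) * M := by gcongr
  linarith

/-- The product of cutoffs in the integrand of `BNhat`. -/
def cutoffProd (X : E2 → ℝ) (M : ℝ) (ξ η : E2) : ℝ :=
  (X (ξ - η + M • e1) + X (ξ - η - M • e1)) * (X (η + M • e1) + X (η - M • e1))

theorem BNhat_eq (X : E2 → ℝ) (N : ℕ) (δ : ℝ) (ξ : E2) :
    BNhat X N δ ξ =
      δ ^ 2 / 8 * ∫ η, ((2 : ℝ) ^ N) ^ 5 * bilinSymbol ξ η * cutoffProd X ((2 : ℝ) ^ N) ξ η := by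
  unfold BNhat bilinSymbol cutoffProd
  simp_rw [mul_assoc (((2 : ℝ) ^ N) ^ 5)]
  rw [integral_const_mul, ← pow_mul, mul_comm N 5]
  simp_rw [mul_assoc (_ / _ : ℝ) (X _ + X _)]
  ring

theorem measurable_bilinSymbol : Measurable fun p : E2 × E2 => bilinSymbol p.1 p.2 := by
  simp only [bilinSymbol, inner_perp]
  fun_prop

theorem measurable_cutoffProd {X : E2 → ℝ} (hX : Measurable X) (M : ℝ) :
    Measurable fun p : E2 × E2 => cutoffProd X M p.1 p.2 := by
  unfold cutoffProd
  fun_prop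

theorem measurable_BNhat {X : E2 → ℝ} (hX : Measurable X) (N : ℕ) (δ : ℝ) :
    Measurable (BNhat X N δ) := by
  have : StronglyMeasurable (fun p : E2 × E2 =>
      ((2 : ℝ) ^ N) ^ 5 * bilinSymbol p.1 p.2 * cutoffProd X ((2 : ℝ) ^ N) p.1 p.2) :=
    ((measurable_bilinSymbol.const_mul _).mul (measurable_cutoffProd hX _)).stronglyMeasurable
  rw [funext (BNhat_eq X N δ)]
  exact this.integral_prod_right.measurable.const_mul _


theorem cutoffProd_nonneg {X : E2 → ℝ} (h0 : ∀ ζ, 0 ≤ X ζ) (M : ℝ) (ξ η : E2) :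
    0 ≤ cutoffProd X M ξ η :=
  mul_nonneg (add_nonneg (h0 _) (h0 _)) (add_nonneg (h0 _) (h0 _))

theorem exists_sign_of_cutoffProd_ne_zero {X : E2 → ℝ} (hout : ∀ ζ, 2 ≤ ‖ζ‖ → X ζ = 0)
    {M : ℝ} {ξ η : E2} (h : cutoffProd X M ξ η ≠ 0) :
    ∃ σ : ℝ, |σ| = 1 ∧ ‖η - (σ * M) • e1‖ ≤ 2 := by
  by_contra! hc
  refine h (mul_eq_zero_of_right _ ?_)
  have h1 := hc (-1) (by norm_num)
  have h2 := hc 1 (by norm_num)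
  rw [hout (η + M • e1) (by simpa using h1.le), hout (η - M • e1) (by simpa using h2.le), add_zero]

theorem cutoffProd_le {X : E2 → ℝ} (h0 : ∀ ζ, 0 ≤ X ζ) (h1 : ∀ ζ, X ζ ≤ 1)
    (hout : ∀ ζ, 2 ≤ ‖ζ‖ → X ζ = 0) (M : ℝ) (ξ η : E2) :
    cutoffProd X M ξ η ≤ (Metric.closedBall (M • e1) 2).indicator (fun _ => (4 : ℝ)) η
      + (Metric.closedBall (-(M • e1)) 2).indicator (fun _ => (4 : ℝ)) η := by
  have hi : ∀ a : E2, 0 ≤ (Metric.closedBall a 2).indicator (fun _ => (4 : ℝ)) η :=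
    fun a => Set.indicator_nonneg (fun _ _ => by norm_num) _
  by_cases h : cutoffProd X M ξ η = 0
  · rw [h]; exact add_nonneg (hi _) (hi _)
  have h4 : cutoffProd X M ξ η ≤ 4 := by
    have t1 := h1 (ξ - η + M • e1)
    have t2 := h1 (ξ - η - M • e1)
    have t3 := h1 (η + M • e1)
    have t4 := h1 (η - M • e1)
    have t5 := add_nonneg (h0 (η + M • e1)) (h0 (η - M • e1))
    calc cutoffProd X M ξ η ≤ (1 + 1) * (1 + 1) := by unfold cutoffProd; gcongr
      _ = 4 := by norm_num
  obtain ⟨σ, hσ, hη⟩ := exists_sign_of_cutoffProd_ne_zero hout h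
  rcases eq_or_eq_neg_of_abs_eq hσ with rfl | rfl
  · rw [Set.indicator_of_mem (by rw [mem_closedBall_iff_norm]; simpa using hη)]
    linarith [hi (-(M • e1))]
  · rw [add_comm, Set.indicator_of_mem (by rw [mem_closedBall_iff_norm]; simpa using hη)]
    linarith [hi (M • e1)]

theorem integrable_indicator_closedBall (a : E2) (r C : ℝ) :
    Integrable ((Metric.closedBall a r).indicator (fun _ => C)) :=
  (integrable_indicator_iff Metric.isClosed_closedBall.measurableSet).2
    (integrableOn_const (measure_closedBall_lt_top).ne)

theorem integral_indicator_closedBall (a : E2) (r C : ℝ) :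
    ∫ η, (Metric.closedBall a r).indicator (fun _ => C) η
      = volume.real (Metric.closedBall (0 : E2) r) * C := by
  rw [integral_indicator_const _ Metric.isClosed_closedBall.measurableSet, smul_eq_mul,
    Measure.addHaar_real_closedBall_center]

theorem integrable_cutoffProd {X : E2 → ℝ} (hX : Measurable X) (h0 : ∀ ζ, 0 ≤ X ζ)
    (h1 : ∀ ζ, X ζ ≤ 1) (hout : ∀ ζ, 2 ≤ ‖ζ‖ → X ζ = 0) (M : ℝ) (ξ : E2) :
    Integrable (cutoffProd X M ξ) := by
  refine ((integrable_indicator_closedBall (M • e1) 2 4).add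
    (integrable_indicator_closedBall (-(M • e1)) 2 4)).mono' ?_ ?_
  · exact ((measurable_cutoffProd hX M).comp measurable_prodMk_left).aestronglyMeasurable
  · refine Filter.Eventually.of_forall fun η => ?_
    rw [Real.norm_of_nonneg (cutoffProd_nonneg h0 M ξ η)]
    exact cutoffProd_le h0 h1 hout M ξ η

theorem integral_cutoffProd_le {X : E2 → ℝ} (hX : Measurable X) (h0 : ∀ ζ, 0 ≤ X ζ)
    (h1 : ∀ ζ, X ζ ≤ 1) (hout : ∀ ζ, 2 ≤ ‖ζ‖ → X ζ = 0) (M : ℝ) (ξ : E2) :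
    ∫ η, cutoffProd X M ξ η ≤ 8 * volume.real (Metric.closedBall (0 : E2) 2) := by
  have i1 := integrable_indicator_closedBall (M • e1) 2 4
  have i2 := integrable_indicator_closedBall (-(M • e1)) 2 4
  refine (integral_mono (integrable_cutoffProd hX h0 h1 hout M ξ) (i1.add i2)
    (cutoffProd_le h0 h1 hout M ξ)).trans_eq ?_
  rw [integral_add' i1 i2, integral_indicator_closedBall, integral_indicator_closedBall]
  ring

theorem le_integral_cutoffProd {X : E2 → ℝ} (hX : Measurable X) (h0 : ∀ ζ, 0 ≤ X ζ)
    (h1 : ∀ ζ, X ζ ≤ 1) (hin : ∀ ζ, ‖ζ‖ ≤ 1 → X ζ = 1) (hout : ∀ ζ, 2 ≤ ‖ζ‖ → X ζ = 0)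
    (M : ℝ) {ξ : E2} (hξ : ‖ξ‖ ≤ 1) :
    volume.real (Metric.closedBall (0 : E2) (1 / 2)) ≤ ∫ η, cutoffProd X M ξ η := by
  rw [← mul_one (volume.real _),
    ← integral_indicator_closedBall (M • e1 + (1 / 2 : ℝ) • ξ) (1 / 2) 1]
  refine integral_mono (integrable_indicator_closedBall _ _ _)
    (integrable_cutoffProd hX h0 h1 hout M ξ) fun η => ?_
  refine Set.indicator_le' (fun η hη => ?_) (fun η _ => cutoffProd_nonneg h0 M ξ η) η
  rw [mem_closedBall_iff_norm] at hη
  set u := η - (M • e1 + (1 / 2 : ℝ) • ξ) with hu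
  have hs : ‖(1 / 2 : ℝ) • ξ‖ ≤ 1 / 2 := by
    rw [norm_smul]; norm_num; linarith
  have a1 : X (ξ - η + M • e1) = 1 := by
    apply hin
    have : ξ - η + M • e1 = (1 / 2 : ℝ) • ξ - u := by rw [hu]; module
    rw [this]
    exact (norm_sub_le _ _).trans (by linarith)
  have a2 : X (η - M • e1) = 1 := by
    apply hin
    have : η - M • e1 = (1 / 2 : ℝ) • ξ + u := by rw [hu]; module
    rw [this]
    exact (norm_add_le _ _).trans (by linarith)
  have t1 := h0 (ξ - η - M • e1)
  have t2 := h0 (η + M • e1)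
  unfold cutoffProd
  rw [a1, a2]
  nlinarith

theorem norm_bilinSymbol_mul_cutoffProd_le {X : E2 → ℝ} (h0 : ∀ ζ, 0 ≤ X ζ)
    (hout : ∀ ζ, 2 ≤ ‖ζ‖ → X ζ = 0) {M : ℝ} (hM : 100 ≤ M) {ξ : E2}
    (hξ0 : 0 < ‖ξ‖) (hξ : ‖ξ‖ ≤ 1) (η : E2) :
    ‖M ^ 5 * bilinSymbol ξ η * cutoffProd X M ξ η‖ ≤ 200 * cutoffProd X M ξ η := by
  by_cases h : cutoffProd X M ξ η = 0
  · simp [h]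
  obtain ⟨σ, hσ, hη⟩ := exists_sign_of_cutoffProd_ne_zero hout h
  have hn := cutoffProd_nonneg h0 M ξ η
  rw [norm_mul, Real.norm_of_nonneg hn]
  gcongr
  exact abs_bilinSymbol_le hM hσ hξ0 hξ hη

theorem integrable_bilinSymbol_mul_cutoffProd {X : E2 → ℝ} (hX : Measurable X)
    (h0 : ∀ ζ, 0 ≤ X ζ) (h1 : ∀ ζ, X ζ ≤ 1) (hout : ∀ ζ, 2 ≤ ‖ζ‖ → X ζ = 0)
    {M : ℝ} (hM : 100 ≤ M) {ξ : E2} (hξ0 : 0 < ‖ξ‖) (hξ : ‖ξ‖ ≤ 1) :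
    Integrable fun η => M ^ 5 * bilinSymbol ξ η * cutoffProd X M ξ η := by
  refine ((integrable_cutoffProd hX h0 h1 hout M ξ).const_mul 200).mono' ?_
    (Filter.Eventually.of_forall (norm_bilinSymbol_mul_cutoffProd_le h0 hout hM hξ0 hξ))
  exact (((measurable_bilinSymbol.const_mul _).mul (measurable_cutoffProd hX M)).comp
    measurable_prodMk_left).aestronglyMeasurable

theorem hundred_le_two_pow {N : ℕ} (hN : 100 ≤ N) : (100 : ℝ) ≤ 2 ^ N := by
  have : N < 2 ^ N := Nat.lt_two_pow_self
  exact_mod_cast hN.trans this.le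

theorem abs_BNhat_le {X : E2 → ℝ} (hX : Measurable X) (h0 : ∀ ζ, 0 ≤ X ζ)
    (h1 : ∀ ζ, X ζ ≤ 1) (hout : ∀ ζ, 2 ≤ ‖ζ‖ → X ζ = 0) {N : ℕ} (hN : 100 ≤ N) (δ : ℝ)
    {ξ : E2} (hξ0 : 0 < ‖ξ‖) (hξ : ‖ξ‖ ≤ 1) :
    |BNhat X N δ ξ| ≤ δ ^ 2 * (200 * volume.real (Metric.closedBall (0 : E2) 2)) := by
  rw [BNhat_eq, abs_mul, abs_of_nonneg (by positivity : 0 ≤ δ ^ 2 / 8)]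
  have := norm_integral_le_of_norm_le
    ((integrable_cutoffProd hX h0 h1 hout (2 ^ N) ξ).const_mul 200) (Filter.Eventually.of_forall
      (norm_bilinSymbol_mul_cutoffProd_le h0 hout (hundred_le_two_pow hN) hξ0 hξ))
  rw [integral_const_mul] at this
  have h8 := integral_cutoffProd_le hX h0 h1 hout (2 ^ N) ξ
  calc _ ≤ δ ^ 2 / 8 * (200 * (8 * volume.real (Metric.closedBall (0 : E2) 2))) := by
        gcongr
        exact this.trans (by gcongr)
    _ = _ := by ring

/-- Multiplying by a weight `p` with the sign of `ξ₁ ξ₂` makes `BNhat` nonnegative up to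
an error of relative size `2^{-N}`. -/
theorem le_mul_BNhat {X : E2 → ℝ} (hX : Measurable X) (h0 : ∀ ζ, 0 ≤ X ζ)
    (h1 : ∀ ζ, X ζ ≤ 1) (hin : ∀ ζ, ‖ζ‖ ≤ 1 → X ζ = 1) (hout : ∀ ζ, 2 ≤ ‖ζ‖ → X ζ = 0)
    {N : ℕ} (hN : 100 ≤ N) (δ : ℝ) {ξ : E2} (hξ0 : 0 < ‖ξ‖) (hξ : ‖ξ‖ ≤ 1) {p : ℝ}
    (hp : |p| ≤ 1) (hp0 : 0 ≤ p * (ξ 0 * ξ 1)) :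
    δ ^ 2 * (p * (ξ 0 * ξ 1) / (1024 * ‖ξ‖ ^ 2)
          * volume.real (Metric.closedBall (0 : E2) (1 / 2))
        - 640 / 2 ^ N * volume.real (Metric.closedBall (0 : E2) 2))
      ≤ p * BNhat X N δ ξ := by
  have hM := hundred_le_two_pow hN
  have iW := integrable_cutoffProd hX h0 h1 hout (2 ^ N) ξ
  set τ := p * (ξ 0 * ξ 1) / (128 * ‖ξ‖ ^ 2) with hτ
  have hτ0 : 0 ≤ τ := by positivity
  have key : (τ - 640 / 2 ^ N) * ∫ η, cutoffProd X (2 ^ N) ξ η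
      ≤ p * ∫ η, ((2 : ℝ) ^ N) ^ 5 * bilinSymbol ξ η * cutoffProd X (2 ^ N) ξ η := by
    rw [← integral_const_mul, ← integral_const_mul]
    refine integral_mono (iW.const_mul _)
      ((integrable_bilinSymbol_mul_cutoffProd hX h0 h1 hout hM hξ0 hξ).const_mul p) fun η => ?_
    by_cases h : cutoffProd X (2 ^ N) ξ η = 0
    · simp [h]
    obtain ⟨σ, hσ, hη⟩ := exists_sign_of_cutoffProd_ne_zero hout h
    have hn := cutoffProd_nonneg h0 (2 ^ N) ξ η
    simp only
    rw [← mul_assoc p]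
    exact mul_le_mul_of_nonneg_right (le_mul_bilinSymbol hM hσ hξ0 hξ hη hp hp0) hn
  have hu := integral_cutoffProd_le hX h0 h1 hout (2 ^ N) ξ
  have hl := le_integral_cutoffProd hX h0 h1 hin hout (2 ^ N) hξ
  rw [BNhat_eq]
  calc _ = δ ^ 2 / 8 * (τ * volume.real (Metric.closedBall (0 : E2) (1 / 2))
        - 640 / 2 ^ N * (8 * volume.real (Metric.closedBall (0 : E2) 2))) := by
        rw [hτ]; field_simp; ring
    _ ≤ δ ^ 2 / 8 * (τ * (∫ η, cutoffProd X (2 ^ N) ξ η)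
        - 640 / 2 ^ N * ∫ η, cutoffProd X (2 ^ N) ξ η) := by gcongr
    _ ≤ δ ^ 2 / 8 * (p * ∫ η, ((2 : ℝ) ^ N) ^ 5 * bilinSymbol ξ η
          * cutoffProd X (2 ^ N) ξ η) := by
        rw [← sub_mul]; gcongr
    _ = _ := by ring

/-- The supremum of an inverse Fourier transform dominates its pairing with the measure whose
transform is `(cos⟪a, ·⟫ - cos⟪b, ·⟫) / 2`. -/
theorem abs_integral_cos_sub_cos_le_iSup {h : E2 → ℝ} (hh : Integrable h) (C : ℂ) (a b : E2) :
    ‖C‖ * |∫ ξ, (Real.cos ⟪a, ξ⟫ - Real.cos ⟪b, ξ⟫) / 2 * h ξ|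
      ≤ ⨆ x : E2, ‖C * ∫ ξ, Complex.exp (Complex.I * ((⟪x, ξ⟫ : ℝ) : ℂ)) * ((h ξ : ℝ) : ℂ)‖ := by
  have hexp : ∀ x ξ : E2, ‖Complex.exp (Complex.I * ((⟪x, ξ⟫ : ℝ) : ℂ))‖ = 1 := fun x ξ => by
    rw [mul_comm]; exact Complex.norm_exp_ofReal_mul_I _
  have hint : ∀ x : E2, Integrable fun ξ =>
      Complex.exp (Complex.I * ((⟪x, ξ⟫ : ℝ) : ℂ)) * ((h ξ : ℝ) : ℂ) := fun x =>
    hh.ofReal.bdd_mul (c := 1) (by fun_prop)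
      (Filter.Eventually.of_forall fun ξ => (hexp x ξ).le)
  have hbdd : BddAbove (Set.range fun x : E2 =>
      ‖C * ∫ ξ, Complex.exp (Complex.I * ((⟪x, ξ⟫ : ℝ) : ℂ)) * ((h ξ : ℝ) : ℂ)‖) := by
    refine ⟨‖C‖ * ∫ ξ, ‖h ξ‖, ?_⟩
    rintro _ ⟨x, rfl⟩
    simp only
    rw [norm_mul]
    gcongr
    refine (norm_integral_le_integral_norm _).trans_eq ?_
    simp [hexp]
  have hre : ∀ x ξ : E2, (Complex.exp (Complex.I * ((⟪x, ξ⟫ : ℝ) : ℂ)) * ((h ξ : ℝ) : ℂ)).re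
      = Real.cos ⟪x, ξ⟫ * h ξ := fun x ξ => by
    rw [mul_comm Complex.I, Complex.re_mul_ofReal, Complex.exp_ofReal_mul_I_re]
  have hcos : ∀ x : E2, Integrable fun ξ => Real.cos ⟪x, ξ⟫ * h ξ := fun x => by
    exact (hint x).re.congr (Filter.Eventually.of_forall (hre x))
  have hle : ∀ x : E2, ‖C‖ * |∫ ξ, Real.cos ⟪x, ξ⟫ * h ξ|
      ≤ ⨆ x : E2, ‖C * ∫ ξ, Complex.exp (Complex.I * ((⟪x, ξ⟫ : ℝ) : ℂ)) * ((h ξ : ℝ) : ℂ)‖ := by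
    intro x
    refine le_trans ?_ (le_ciSup hbdd x)
    rw [norm_mul]
    gcongr
    have : ∫ ξ, Real.cos ⟪x, ξ⟫ * h ξ
        = (∫ ξ, Complex.exp (Complex.I * ((⟪x, ξ⟫ : ℝ) : ℂ)) * ((h ξ : ℝ) : ℂ)).re :=
      (integral_congr_ae (Filter.Eventually.of_forall fun ξ => (hre x ξ).symm)).trans
        (integral_re (hint x))
    rw [this]
    exact Complex.abs_re_le_norm _
  have e : ∫ ξ, (Real.cos ⟪a, ξ⟫ - Real.cos ⟪b, ξ⟫) / 2 * h ξ
      = ((∫ ξ, Real.cos ⟪a, ξ⟫ * h ξ) - ∫ ξ, Real.cos ⟪b, ξ⟫ * h ξ) / 2 := by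
    rw [← integral_sub (hcos a) (hcos b), ← integral_div]
    congr 1; ext ξ; ring
  rw [e, abs_div, abs_two]
  have t := abs_sub (∫ ξ, Real.cos ⟪a, ξ⟫ * h ξ) (∫ ξ, Real.cos ⟪b, ξ⟫ * h ξ)
  have := mul_le_mul_of_nonneg_left t (norm_nonneg C)
  linarith [hle a, hle b]

theorem mul_sin_nonneg {s : ℝ} (hs : |s| ≤ 2) : 0 ≤ s * Real.sin s := by
  obtain ⟨h1, h2⟩ := abs_le.1 hs
  have hπ := Real.pi_gt_three
  rcases le_total 0 s with h | h
  · exact mul_nonneg h (Real.sin_nonneg_of_nonneg_of_le_pi h (by linarith))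
  · exact mul_nonneg_of_nonpos_of_nonpos h
      (Real.sin_nonpos_of_nonpos_of_neg_pi_le h (by linarith))

theorem half_le_sin {s : ℝ} (h0 : 0 ≤ s) (h1 : s ≤ 3 / 2) : s / 2 ≤ Real.sin s := by
  have hπ := Real.pi_gt_three
  refine le_trans ?_ (Real.mul_le_sin h0 (by linarith))
  rw [div_eq_inv_mul]
  gcongr
  rw [le_div_iff₀ Real.pi_pos]
  linarith [Real.pi_le_four]

theorem cos_sub_cos_eq_sin_mul_sin (r : ℝ) (ξ : E2) :
    (Real.cos ⟪r • (!₂[1, -1] : E2), ξ⟫ - Real.cos ⟪r • (!₂[1, 1] : E2), ξ⟫) / 2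
      = Real.sin ((r • ξ) 0) * Real.sin ((r • ξ) 1) := by
  have e1 : ⟪r • (!₂[1, -1] : E2), ξ⟫ = (r • ξ) 0 - (r • ξ) 1 := by
    rw [inner_eq_coord]; simp; ring
  have e2 : ⟪r • (!₂[1, 1] : E2), ξ⟫ = (r • ξ) 0 + (r • ξ) 1 := by
    rw [inner_eq_coord]; simp
  rw [e1, e2, Real.cos_sub, Real.cos_add]
  ring

/-- The center of a ball in the open first quadrant on which every dyadic partition function has
Fourier transform equal to `1`. -/
def quadrantCenter : E2 := !₂[7 / 10, 7 / 10]

theorem bounds_of_mem_closedBall_quadrantCenter {u : E2}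
    (hu : u ∈ Metric.closedBall quadrantCenter (1 / 10)) :
    7 / 8 ≤ ‖u‖ ∧ ‖u‖ ≤ 5 / 4 ∧ 3 / 5 ≤ u 0 ∧ 3 / 5 ≤ u 1 := by
  rw [mem_closedBall_iff_norm] at hu
  have hc : ‖quadrantCenter‖ ^ 2 = 98 / 100 := by
    rw [norm_sq_eq_coord]; norm_num [quadrantCenter]
  have c1 : 39 / 40 ≤ ‖quadrantCenter‖ := by
    nlinarith [norm_nonneg quadrantCenter]
  have c2 : ‖quadrantCenter‖ ≤ 1 := by
    nlinarith [norm_nonneg quadrantCenter]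
  have h1 := abs_le.1 (abs_norm_sub_norm_le u quadrantCenter)
  have h2 := abs_le.1 ((abs_coord_le (u - quadrantCenter) 0).trans hu)
  have h3 := abs_le.1 ((abs_coord_le (u - quadrantCenter) 1).trans hu)
  simp only [quadrantCenter, PiLp.sub_apply] at h2 h3
  norm_num at h2 h3
  exact ⟨by linarith, by linarith, by linarith, by linarith⟩

theorem le_sin_mul_sin_mul_div {u : E2}
    (hu : u ∈ Metric.closedBall quadrantCenter (1 / 10)) :
    1 / 100000 ≤ Real.sin (u 0) * Real.sin (u 1) * (u 0 * u 1) / (1024 * ‖u‖ ^ 2) := by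
  obtain ⟨h1, h2, h3, h4⟩ := bounds_of_mem_closedBall_quadrantCenter hu
  have b0 := (le_abs_self _).trans (abs_coord_le u 0)
  have b1 := (le_abs_self _).trans (abs_coord_le u 1)
  have s0 : 3 / 10 ≤ Real.sin (u 0) := by
    linarith [half_le_sin (s := u 0) (by linarith) (by linarith)]
  have s1 : 3 / 10 ≤ Real.sin (u 1) := by
    linarith [half_le_sin (s := u 1) (by linarith) (by linarith)]
  rw [le_div_iff₀ (by positivity)]
  calc 1 / 100000 * (1024 * ‖u‖ ^ 2) ≤ 1 / 100000 * (1024 * (5 / 4) ^ 2) := by gcongr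
    _ ≤ 3 / 10 * (3 / 10) * (3 / 5 * (3 / 5)) := by norm_num
    _ ≤ _ := by gcongr

theorem DyadicData.measurable_Φ (D : DyadicData) : Measurable D.Φ :=
  measurable_of_FT_eq D.φ.continuous.measurable D.hFT

theorem DyadicData.norm_bounds (D : DyadicData) {r : ℝ} (hr : 2 ≤ r) {ξ : E2}
    (h : D.Φ (r • ξ) ≠ 0) : 0 < ‖ξ‖ ∧ ‖ξ‖ ≤ 1 := by
  obtain ⟨h1, h2⟩ := D.hsupp _ h
  rw [norm_smul, Real.norm_of_nonneg (by linarith)] at h1 h2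
  constructor
  · by_contra! hc
    have := le_antisymm hc (norm_nonneg ξ)
    rw [this] at h1
    norm_num at h1
  · nlinarith [norm_nonneg ξ]

theorem integrable_Φ_mul_BNhat {X : E2 → ℝ} (hX : Measurable X) (h0 : ∀ ζ, 0 ≤ X ζ)
    (h1 : ∀ ζ, X ζ ≤ 1) (hout : ∀ ζ, 2 ≤ ‖ζ‖ → X ζ = 0) (D : DyadicData) {N : ℕ}
    (hN : 100 ≤ N) (δ : ℝ) {r : ℝ} (hr : 2 ≤ r) :
    Integrable fun ξ => D.Φ (r • ξ) * BNhat X N δ ξ := by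
  refine (integrable_indicator_closedBall 0 1
    (δ ^ 2 * (200 * volume.real (Metric.closedBall (0 : E2) 2)))).mono'
    ((D.measurable_Φ.comp (measurable_const_smul r)).mul
      (measurable_BNhat hX N δ)).aestronglyMeasurable (Filter.Eventually.of_forall fun ξ => ?_)
  by_cases h : D.Φ (r • ξ) = 0
  · rw [h, zero_mul, norm_zero]
    exact Set.indicator_nonneg (fun _ _ => by positivity) _
  obtain ⟨hξ0, hξ⟩ := D.norm_bounds hr h
  rw [Set.indicator_of_mem (by simpa using hξ), norm_mul, Real.norm_of_nonneg (D.h0 _)]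
  exact (mul_le_of_le_one_left (norm_nonneg _) (D.h1 _)).trans
    (abs_BNhat_le hX h0 h1 hout hN δ hξ0 hξ)

theorem le_integral_sin_mul_sin_mul_BNhat {X : E2 → ℝ} (hX : Measurable X)
    (h0 : ∀ ζ, 0 ≤ X ζ) (h1 : ∀ ζ, X ζ ≤ 1) (hin : ∀ ζ, ‖ζ‖ ≤ 1 → X ζ = 1)
    (hout : ∀ ζ, 2 ≤ ‖ζ‖ → X ζ = 0) (D : DyadicData) {N : ℕ}
    (hN : 100 ≤ N) (δ : ℝ) {r : ℝ} (hr : 2 ≤ r) :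
    (r ^ 2)⁻¹ * (δ ^ 2 * (volume.real (Metric.closedBall (0 : E2) (1 / 10))
          * (1 / 100000 * volume.real (Metric.closedBall (0 : E2) (1 / 2)))
        - volume.real (Metric.closedBall (0 : E2) 2)
          * (640 / 2 ^ N * volume.real (Metric.closedBall (0 : E2) 2))))
      ≤ ∫ ξ, Real.sin ((r • ξ) 0) * Real.sin ((r • ξ) 1) * (D.Φ (r • ξ) * BNhat X N δ ξ) := by
  set v := volume.real (Metric.closedBall (0 : E2) (1 / 2))
  set V := volume.real (Metric.closedBall (0 : E2) 2)
  set g : E2 → ℝ := fun u => δ ^ 2 *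
    ((Metric.closedBall quadrantCenter (1 / 10)).indicator (fun _ => 1 / 100000 * v) u
      - (Metric.closedBall (0 : E2) 2).indicator (fun _ => 640 / 2 ^ N * V) u) with hg
  have iA := integrable_indicator_closedBall quadrantCenter (1 / 10) (1 / 100000 * v)
  have iB := integrable_indicator_closedBall 0 2 (640 / 2 ^ N * V)
  have ig : Integrable g := (iA.sub iB).const_mul _
  have hr0 : r ≠ 0 := by linarith
  have hrpos : 0 < r := by linarith
  have e : ∫ ξ, g (r • ξ) = (r ^ 2)⁻¹ * (δ ^ 2 *
      (volume.real (Metric.closedBall (0 : E2) (1 / 10)) * (1 / 100000 * v)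
        - V * (640 / 2 ^ N * V))) := by
    rw [Measure.integral_comp_smul, hg, integral_const_mul, integral_sub iA iB,
      integral_indicator_closedBall, integral_indicator_closedBall, finrank_euclideanSpace,
      Fintype.card_fin, abs_of_nonneg (by positivity), smul_eq_mul]
  rw [← e]
  have hs : ∀ ξ : E2, |Real.sin ((r • ξ) 0) * Real.sin ((r • ξ) 1)| ≤ 1 := fun ξ => by
    rw [abs_mul]
    exact mul_le_one₀ (Real.abs_sin_le_one _) (abs_nonneg _) (Real.abs_sin_le_one _)
  refine integral_mono ((integrable_comp_smul_iff volume g hr0).2 ig)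
    ((integrable_Φ_mul_BNhat hX h0 h1 hout D hN δ hr).bdd_mul (c := 1)
      (by fun_prop) (Filter.Eventually.of_forall hs)) fun ξ => ?_
  simp only [hg]
  by_cases h : D.Φ (r • ξ) = 0
  · have hA : r • ξ ∉ Metric.closedBall quadrantCenter (1 / 10) := fun hA => by
      obtain ⟨b1, b2, -, -⟩ := bounds_of_mem_closedBall_quadrantCenter hA
      rw [D.hone _ b1 b2] at h
      exact one_ne_zero h
    rw [h, Set.indicator_of_notMem hA, zero_mul, mul_zero, zero_sub, mul_neg, neg_nonpos]
    exact mul_nonneg (sq_nonneg _) (Set.indicator_nonneg (fun _ _ => by positivity) _)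
  obtain ⟨hξ0, hξ⟩ := D.norm_bounds hr h
  have hu2 := (D.hsupp _ h).2
  have hΦ := D.h0 (r • ξ)
  set p := Real.sin ((r • ξ) 0) * Real.sin ((r • ξ) 1) * D.Φ (r • ξ) with hp
  have hp1 : |p| ≤ 1 := by
    rw [hp, abs_mul, abs_of_nonneg hΦ]
    exact mul_le_one₀ (hs ξ) hΦ (D.h1 _)
  have hc0 : (r • ξ) 0 = r * ξ 0 := rfl
  have hc1 : (r • ξ) 1 = r * ξ 1 := rfl
  have hratio : p * (ξ 0 * ξ 1) / (1024 * ‖ξ‖ ^ 2)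
      = p * ((r • ξ) 0 * (r • ξ) 1) / (1024 * ‖r • ξ‖ ^ 2) := by
    rw [norm_smul, Real.norm_of_nonneg hrpos.le, hc0, hc1]
    field_simp
  have hpu : 0 ≤ p * ((r • ξ) 0 * (r • ξ) 1) := by
    have t0 := mul_sin_nonneg ((abs_coord_le (r • ξ) 0).trans hu2)
    have t1 := mul_sin_nonneg ((abs_coord_le (r • ξ) 1).trans hu2)
    have := mul_nonneg (mul_nonneg t0 t1) hΦ
    rw [hp]; linarith
  have hp0 : 0 ≤ p * (ξ 0 * ξ 1) := by
    have : p * ((r • ξ) 0 * (r • ξ) 1) = r ^ 2 * (p * (ξ 0 * ξ 1)) := by rw [hc0, hc1]; ring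
    rw [this] at hpu
    exact nonneg_of_mul_nonneg_right hpu (by positivity)
  rw [← mul_assoc, ← hp]
  refine le_trans ?_ (le_mul_BNhat hX h0 h1 hin hout hN δ hξ0 hξ hp1 hp0)
  rw [Set.indicator_of_mem (s := Metric.closedBall (0 : E2) 2) (by simpa using hu2)]
  gcongr
  rw [hratio]
  by_cases hA : r • ξ ∈ Metric.closedBall quadrantCenter (1 / 10)
  · obtain ⟨b1, b2, -, -⟩ := bounds_of_mem_closedBall_quadrantCenter hA
    rw [Set.indicator_of_mem hA, hp, D.hone _ b1 b2, mul_one]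
    exact mul_le_mul_of_nonneg_right (le_sin_mul_sin_mul_div hA) measureReal_nonneg
  · rw [Set.indicator_of_notMem hA]
    positivity

/-- lower bound `2^{−j} ‖φ_j ∗ θ_N^{(2)}‖_{L^∞} ≥ c δ² 2^{j}` for
the low-frequency pieces of the second Picard iterate, i.e.
`sup_x |(2π)^{−2} ∫ e^{ix·ξ} φ̂₀(2^{−j}ξ) B̂_N(ξ) dξ| ≥ c δ² 2^{2j}` for `j ≤ −1`. -/
theorem stmt12 (χ : SchwartzMap E2 ℝ) (X : E2 → ℝ)
    (hX : ∀ ζ : E2, FT (fun x => ((χ x : ℝ) : ℂ)) ζ = ((X ζ : ℝ) : ℂ))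
    (h0 : ∀ ζ : E2, 0 ≤ X ζ) (h1 : ∀ ζ : E2, X ζ ≤ 1)
    (hin : ∀ ζ : E2, ‖ζ‖ ≤ 1 → X ζ = 1)
    (hout : ∀ ζ : E2, 2 ≤ ‖ζ‖ → X ζ = 0)
    (D : DyadicData) :
    ∃ c : ℝ, 0 < c ∧ ∃ N₀ : ℕ, 100 ≤ N₀ ∧
      ∀ N : ℕ, N₀ ≤ N → ∀ δ : ℝ, 0 < δ → ∀ j : ℤ, j ≤ -1 →
        c * δ ^ 2 * (2 : ℝ) ^ (2 * j) ≤
          ⨆ x : E2, ‖(((2 * Real.pi) ^ 2 : ℝ) : ℂ)⁻¹ *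
            ∫ ξ : E2, Complex.exp (Complex.I * ((⟪x, ξ⟫ : ℝ) : ℂ)) *
              ((D.Φ ((2 : ℝ) ^ (-j) • ξ) : ℝ) : ℂ) * ((BNhat X N δ ξ : ℝ) : ℂ)‖ := by
  have hXm : Measurable X :=
    measurable_of_FT_eq (Complex.measurable_ofReal.comp χ.continuous.measurable) hX
  have hpos : ∀ r : ℝ, 0 < r → 0 < volume.real (Metric.closedBall (0 : E2) r) := fun r hr =>
    ENNReal.toReal_pos (Metric.measure_closedBall_pos volume 0 hr).ne'
      measure_closedBall_lt_top.ne
  set V := volume.real (Metric.closedBall (0 : E2) 2) with hV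
  set κ := volume.real (Metric.closedBall (0 : E2) (1 / 10))
    * (1 / 100000 * volume.real (Metric.closedBall (0 : E2) (1 / 2))) with hκ
  have hV0 : 0 < V := hpos 2 (by norm_num)
  have hκ0 : 0 < κ := mul_pos (hpos _ (by norm_num)) (mul_pos (by norm_num) (hpos _ (by norm_num)))
  obtain ⟨n, hn⟩ := pow_unbounded_of_one_lt (1280 * V ^ 2 / κ) (one_lt_two : (1 : ℝ) < 2)
  refine ⟨((2 * Real.pi) ^ 2)⁻¹ * (κ / 2), by positivity, max n 100, le_max_right _ _, ?_⟩
  intro N hN δ _ j hj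
  have hN100 : 100 ≤ N := (le_max_right _ _).trans hN
  have hr : (2 : ℝ) ≤ 2 ^ (-j) := by
    simpa using zpow_le_zpow_right₀ (one_le_two : (1 : ℝ) ≤ 2) (show (1 : ℤ) ≤ -j by lia)
  have herr : V * (640 / 2 ^ N * V) ≤ κ / 2 := by
    have h2 : (2 : ℝ) ^ n ≤ 2 ^ N :=
      pow_le_pow_right₀ one_le_two ((le_max_left _ _).trans hN)
    have h3 : 1280 * V ^ 2 ≤ 2 ^ N * κ := (div_le_iff₀ hκ0).1 (hn.le.trans h2)
    have h4 : V * (640 / 2 ^ N * V) = 1280 * V ^ 2 / (2 * 2 ^ N) := by field_simp; norm_num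
    rw [h4, div_le_div_iff₀ (by positivity) two_pos]
    linarith
  have hlow := le_integral_sin_mul_sin_mul_BNhat hXm h0 h1 hin hout D hN100 δ hr
  have hsup := abs_integral_cos_sub_cos_le_iSup
    (integrable_Φ_mul_BNhat hXm h0 h1 hout D hN100 δ hr) ((((2 * Real.pi) ^ 2 : ℝ) : ℂ)⁻¹)
    ((2 : ℝ) ^ (-j) • !₂[1, -1]) ((2 : ℝ) ^ (-j) • !₂[1, 1])
  simp only [cos_sub_cos_eq_sin_mul_sin, Complex.ofReal_mul (D.Φ _), ← mul_assoc (cexp _)] at hsup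
  refine le_trans ?_ hsup
  have hj2 : (2 : ℝ) ^ (2 * j) = (((2 : ℝ) ^ (-j)) ^ 2)⁻¹ := by
    rw [zpow_neg, inv_pow, inv_inv, mul_comm, zpow_mul]; norm_cast
  have hC : ‖((((2 * Real.pi) ^ 2 : ℝ) : ℂ))⁻¹‖ = ((2 * Real.pi) ^ 2)⁻¹ := by
    rw [norm_inv, Complex.norm_real, Real.norm_of_nonneg (by positivity)]
  rw [hC, hj2]
  calc _ = ((2 * Real.pi) ^ 2)⁻¹ * ((((2 : ℝ) ^ (-j)) ^ 2)⁻¹ * (δ ^ 2 * (κ - κ / 2))) := by ring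
    _ ≤ ((2 * Real.pi) ^ 2)⁻¹ * ((((2 : ℝ) ^ (-j)) ^ 2)⁻¹
          * (δ ^ 2 * (κ - V * (640 / 2 ^ N * V)))) := by gcongr
    _ ≤ _ := by
        gcongr
        exact hlow.trans (le_abs_self _)
end
end

section
/- Let φ₀ : ℝ² → ℂ be a Schwartz function. There exist R ≥ 1 and C > 0, depending only on φ₀, such that for every integer N ≥ 200, ( ∫_{ℝ²} | Σ_{k=10}^{N−50} 2^{k²/2} φ₀(2^{k²}(x − R k² e₁)) |⁴ dx )^{1/4} ≤ C N^{1/4}. -/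
open MeasureTheory Complex
open scoped RealInnerProductSpace ENNReal NNReal

noncomputable section

/-- Weighted Cauchy–Schwarz, used twice, with the summable weights `2⁻ᵏ`. -/
lemma sum_pow_four_le_sum_two_pow_mul (s : Finset ℕ) (hs : ∀ k ∈ s, 1 ≤ k) (b : ℕ → ℝ) :
    (∑ k ∈ s, b k) ^ 4 ≤ ∑ k ∈ s, (2 : ℝ) ^ (3 * k) * b k ^ 4 := by
  have hw : ∑ k ∈ s, ((1 : ℝ) / 2) ^ k ≤ 1 := by
    have hinj : ∑ k ∈ s, ((1 : ℝ) / 2) ^ k ≤ ∑' k : ℕ, ((1 : ℝ) / 2) ^ (k + 1) := by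
      have himage : ∑ k ∈ s, ((1 : ℝ) / 2) ^ k =
          ∑ k ∈ s.image (fun k => k - 1), ((1 : ℝ) / 2) ^ (k + 1) := by
        rw [Finset.sum_image]
        · refine Finset.sum_congr rfl fun k hk => ?_
          rw [Nat.sub_add_cancel (hs k hk)]
        · intro k hk l hl hkl
          have := hs k hk
          have := hs l hl
          simp only at hkl
          omega
      rw [himage]
      refine Summable.sum_le_tsum _ (fun k _ => by positivity) ?_
      exact (summable_nat_add_iff 1).2 summable_geometric_two
    refine hinj.trans_eq ?_
    simp_rw [pow_succ]
    rw [tsum_mul_right, tsum_geometric_two]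
    norm_num
  have hcs₁ : (∑ k ∈ s, b k) ^ 2 ≤
      (∑ k ∈ s, ((1 : ℝ) / 2) ^ k) * ∑ k ∈ s, (2 : ℝ) ^ k * b k ^ 2 := by
    refine Finset.sum_sq_le_sum_mul_sum_of_sq_le_mul s (fun k _ => by positivity)
      (fun k _ => by positivity) fun k _ => ?_
    rw [← mul_assoc, ← mul_pow]
    norm_num
  have hcs₂ : (∑ k ∈ s, (2 : ℝ) ^ k * b k ^ 2) ^ 2 ≤
      (∑ k ∈ s, ((1 : ℝ) / 2) ^ k) * ∑ k ∈ s, (2 : ℝ) ^ (3 * k) * b k ^ 4 := by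
    refine Finset.sum_sq_le_sum_mul_sum_of_sq_le_mul s (fun k _ => by positivity)
      (fun k _ => by positivity) fun k _ => ?_
    have h : ((1 : ℝ) / 2) ^ k * 2 ^ k = 1 := by rw [← mul_pow]; norm_num
    calc ((2 : ℝ) ^ k * b k ^ 2) ^ 2 = (1 / 2) ^ k * 2 ^ k * (2 ^ k) ^ 2 * b k ^ 4 := by
          rw [h]; ring
      _ ≤ (1 / 2) ^ k * ((2 : ℝ) ^ (3 * k) * b k ^ 4) := by
          rw [pow_mul' (2 : ℝ) 3 k]
          exact le_of_eq (by ring)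
  have hnn₁ : 0 ≤ ∑ k ∈ s, (2 : ℝ) ^ k * b k ^ 2 :=
    Finset.sum_nonneg fun k _ => by positivity
  have hnn₂ : 0 ≤ ∑ k ∈ s, (2 : ℝ) ^ (3 * k) * b k ^ 4 :=
    Finset.sum_nonneg fun k _ => by positivity
  calc (∑ k ∈ s, b k) ^ 4 = ((∑ k ∈ s, b k) ^ 2) ^ 2 := by ring
    _ ≤ (∑ k ∈ s, (2 : ℝ) ^ k * b k ^ 2) ^ 2 := by
        gcongr
        exact hcs₁.trans (mul_le_of_le_one_left hnn₁ hw)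
    _ ≤ _ := hcs₂.trans (mul_le_of_le_one_left hnn₂ hw)

/-- If at most one of the distances `t k` is smaller than `1/2`, the corresponding term is
isolated and all the others are controlled by their decay. -/
lemma sum_pow_four_le_of_separated (s : Finset ℕ) (hs : ∀ k ∈ s, 1 ≤ k) (b t : ℕ → ℝ)
    (ht : ∀ k ∈ s, ∀ l ∈ s, k ≠ l → 1 ≤ t k + t l) :
    (∑ k ∈ s, b k) ^ 4 ≤
      ∑ k ∈ s, (8 * b k ^ 4 + 128 * ((2 : ℝ) ^ (3 * k) * (t k * b k) ^ 4)) := by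
  have hconv (u v : ℝ) : (u + v) ^ 4 ≤ 8 * u ^ 4 + 8 * v ^ 4 := by
    nlinarith [sq_nonneg (u - v), sq_nonneg (u + v), sq_nonneg (u ^ 2 - v ^ 2),
      mul_nonneg (sq_nonneg (u - v)) (sq_nonneg (u + v)), sq_nonneg ((u - v) ^ 2),
      mul_nonneg (sq_nonneg (u - v)) (sq_nonneg u), mul_nonneg (sq_nonneg (u - v)) (sq_nonneg v)]
  have hnear : (∑ k ∈ s with t k < 1 / 2, b k) ^ 4 ≤ ∑ k ∈ s, b k ^ 4 := by
    have hcard : (s.filter fun k => t k < 1 / 2).card ≤ 1 := by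
      rw [Finset.card_le_one]
      intro k hk l hl
      rw [Finset.mem_filter] at hk hl
      by_contra hkl
      linarith [ht k hk.1 l hl.1 hkl]
    have heq : (∑ k ∈ s with t k < 1 / 2, b k) ^ 4 = ∑ k ∈ s with t k < 1 / 2, b k ^ 4 := by
      rcases Finset.card_le_one_iff_subset_singleton.1 hcard with ⟨i, hi⟩
      rcases Finset.subset_singleton_iff.1 hi with h | h <;> rw [h] <;> simp
    rw [heq]
    exact Finset.sum_le_sum_of_subset_of_nonneg (Finset.filter_subset _ _)
      fun k _ _ => by positivity
  have hfar : (∑ k ∈ s with ¬ t k < 1 / 2, b k) ^ 4 ≤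
      ∑ k ∈ s, 16 * ((2 : ℝ) ^ (3 * k) * (t k * b k) ^ 4) := by
    refine (sum_pow_four_le_sum_two_pow_mul _
      (fun k hk => hs k (Finset.mem_filter.1 hk).1) b).trans ?_
    refine (Finset.sum_le_sum fun k hk => ?_).trans
      (Finset.sum_le_sum_of_subset_of_nonneg (Finset.filter_subset _ _)
        fun k _ _ => by positivity)
    have htk : 1 / 2 ≤ t k := not_lt.1 (Finset.mem_filter.1 hk).2
    have h16 : 1 ≤ 16 * t k ^ 4 := by
      have := pow_le_pow_left₀ (by norm_num) htk 4
      linarith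
    calc (2 : ℝ) ^ (3 * k) * b k ^ 4 = 1 * ((2 : ℝ) ^ (3 * k) * b k ^ 4) := (one_mul _).symm
      _ ≤ 16 * t k ^ 4 * ((2 : ℝ) ^ (3 * k) * b k ^ 4) := by gcongr
      _ = 16 * ((2 : ℝ) ^ (3 * k) * (t k * b k) ^ 4) := by ring
  rw [← Finset.sum_filter_add_sum_filter_not s (fun k => t k < 1 / 2) b, Finset.sum_add_distrib,
    ← Finset.mul_sum, ← Finset.mul_sum]
  rw [← Finset.mul_sum] at hfar
  linarith [hconv (∑ k ∈ s with t k < 1 / 2, b k) (∑ k ∈ s with ¬ t k < 1 / 2, b k)]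

lemma SchwartzMap.integrable_pow_mul_norm_pow_four (φ : SchwartzMap E2 ℂ) (n : ℕ) :
    Integrable fun y : E2 => ‖y‖ ^ n * ‖φ y‖ ^ 4 := by
  obtain ⟨C, hC⟩ := φ.decay 0 0
  have hbound (y : E2) : ‖φ y‖ ≤ C := by simpa using hC.2 y
  refine ((φ.integrable_pow_mul volume n).const_mul (C ^ 3)).mono'
    (by have := φ.continuous; fun_prop) (Filter.Eventually.of_forall fun y => ?_)
  rw [Real.norm_of_nonneg (by positivity)]
  calc ‖y‖ ^ n * ‖φ y‖ ^ 4 = ‖φ y‖ ^ 3 * (‖y‖ ^ n * ‖φ y‖) := by ring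
    _ ≤ C ^ 3 * (‖y‖ ^ n * ‖φ y‖) := by
        gcongr
        exact hbound y

lemma integrable_comp_smul_sub {H : E2 → ℝ} (hH : Integrable H) {a : ℝ} (ha : a ≠ 0) (c : E2) :
    Integrable fun x => H (a • (x - c)) :=
  (hH.comp_smul ha).comp_sub_right c

lemma integral_sq_mul_comp_smul_sub (H : E2 → ℝ) {a : ℝ} (ha : 0 < a) (c : E2) :
    ∫ x, a ^ 2 * H (a • (x - c)) = ∫ x, H x := by
  rw [integral_const_mul, integral_sub_right_eq_self (fun x => H (a • x)) c,
    Measure.integral_comp_smul, finrank_euclideanSpace_fin, abs_of_pos (by positivity),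
    smul_eq_mul, mul_inv_cancel_left₀ (by positivity)]

/-- Translates along `e₁` by distinct squares are at distance at least `1`. -/
lemma one_le_norm_sub_add_norm_sub (x : E2) {k l : ℕ} (hkl : k ≠ l) :
    1 ≤ ‖x - ((1 : ℝ) * (k : ℝ) ^ 2) • e1‖ + ‖x - ((1 : ℝ) * (l : ℝ) ^ 2) • e1‖ := by
  have hint : (1 : ℝ) ≤ |(k : ℝ) ^ 2 - (l : ℝ) ^ 2| := by
    have h : (1 : ℤ) ≤ |(k : ℤ) ^ 2 - (l : ℤ) ^ 2| := by
      refine Int.one_le_abs (sub_ne_zero.2 fun h => hkl ?_)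
      exact Nat.pow_left_injective two_ne_zero (by exact_mod_cast h)
    exact_mod_cast h
  have he : ‖e1‖ = 1 := by simp [e1]
  calc (1 : ℝ) ≤ |(k : ℝ) ^ 2 - (l : ℝ) ^ 2| := hint
    _ = ‖((1 : ℝ) * (k : ℝ) ^ 2) • e1 - ((1 : ℝ) * (l : ℝ) ^ 2) • e1‖ := by
        rw [← sub_smul, norm_smul, he, mul_one, Real.norm_eq_abs, one_mul, one_mul]
    _ = dist (((1 : ℝ) * (k : ℝ) ^ 2) • e1) (((1 : ℝ) * (l : ℝ) ^ 2) • e1) :=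
        (dist_eq_norm _ _).symm
    _ ≤ dist x (((1 : ℝ) * (k : ℝ) ^ 2) • e1) + dist x (((1 : ℝ) * (l : ℝ) ^ 2) • e1) :=
        dist_triangle_left _ _ _
    _ = _ := by rw [dist_eq_norm, dist_eq_norm]

lemma two_rpow_sq_div_two_pow_four (k : ℕ) :
    ((2 : ℝ) ^ (((k : ℝ) ^ 2) / 2)) ^ 4 = ((2 : ℝ) ^ (k ^ 2)) ^ 2 := by
  rw [← Real.rpow_natCast, ← Real.rpow_mul zero_le_two, ← pow_mul, ← Real.rpow_natCast 2 (k ^ 2 * 2)]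
  congr 1
  push_cast
  ring

lemma norm_sum_pow_four_le (φ : SchwartzMap E2 ℂ) (s : Finset ℕ) (hs : ∀ k ∈ s, 1 ≤ k) (x : E2) :
    ‖∑ k ∈ s, (2 : ℝ) ^ (((k : ℝ) ^ 2) / 2) •
        φ (((2 : ℝ) ^ (k ^ 2)) • (x - ((1 : ℝ) * (k : ℝ) ^ 2) • e1))‖ ^ 4 ≤
      ∑ k ∈ s, ((2 : ℝ) ^ (k ^ 2)) ^ 2 *
        (fun y : E2 => 8 * (‖y‖ ^ 0 * ‖φ y‖ ^ 4) + 128 * (‖y‖ ^ 4 * ‖φ y‖ ^ 4))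
          (((2 : ℝ) ^ (k ^ 2)) • (x - ((1 : ℝ) * (k : ℝ) ^ 2) • e1)) := by
  refine (pow_le_pow_left₀ (norm_nonneg _) (norm_sum_le _ _) 4).trans ?_
  refine (sum_pow_four_le_of_separated s hs _
    (fun k => ‖x - ((1 : ℝ) * (k : ℝ) ^ 2) • e1‖)
    fun k _ l _ hkl => one_le_norm_sub_add_norm_sub x hkl).trans ?_
  refine Finset.sum_le_sum fun k hk => ?_
  have hpow : (2 : ℝ) ^ (3 * k) ≤ ((2 : ℝ) ^ (k ^ 2)) ^ 4 := by
    rw [← pow_mul]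
    refine pow_le_pow_right₀ one_le_two ?_
    nlinarith [hs k hk]
  set p := (2 : ℝ) ^ (k ^ 2) with hp
  set z := x - ((1 : ℝ) * (k : ℝ) ^ 2) • e1
  have hp0 : 0 < p := by positivity
  have hnorm : ‖(2 : ℝ) ^ (((k : ℝ) ^ 2) / 2) • φ (p • z)‖ ^ 4 = p ^ 2 * ‖φ (p • z)‖ ^ 4 := by
    rw [norm_smul, mul_pow, Real.norm_of_nonneg (by positivity), two_rpow_sq_div_two_pow_four]
  have hz : ‖p • z‖ = p * ‖z‖ := by rw [norm_smul, Real.norm_of_nonneg hp0.le]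
  simp only [mul_pow ‖z‖, hnorm, hz, pow_zero, one_mul]
  calc 8 * (p ^ 2 * ‖φ (p • z)‖ ^ 4) +
        128 * ((2 : ℝ) ^ (3 * k) * (‖z‖ ^ 4 * (p ^ 2 * ‖φ (p • z)‖ ^ 4)))
      ≤ 8 * (p ^ 2 * ‖φ (p • z)‖ ^ 4) +
        128 * (p ^ 4 * (‖z‖ ^ 4 * (p ^ 2 * ‖φ (p • z)‖ ^ 4))) := by gcongr
    _ = p ^ 2 * (8 * ‖φ (p • z)‖ ^ 4 + 128 * ((p * ‖z‖) ^ 4 * ‖φ (p • z)‖ ^ 4)) := by ring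


/-- `L⁴` bound `‖F_N‖_{L⁴} ≤ C N^{1/4}` for the sum of separated
dilated bumps `F_N = Σ_{k=10}^{N−50} 2^{−(3/2)k²} φ_{k²}(· − Rk² e₁)`. -/
theorem stmt13 (φ₀ : SchwartzMap E2 ℂ) :
    ∃ R : ℝ, 1 ≤ R ∧ ∃ C : ℝ, 0 < C ∧
      ∀ N : ℕ, 200 ≤ N →
        (∫ x : E2, ‖∑ k ∈ Finset.Icc 10 (N - 50),
            (2 : ℝ) ^ (((k : ℝ) ^ 2) / 2) •
              φ₀ (((2 : ℝ) ^ (k ^ 2)) • (x - (R * (k : ℝ) ^ 2) • e1))‖ ^ 4) ^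
            ((1 : ℝ) / 4) ≤
          C * (N : ℝ) ^ ((1 : ℝ) / 4) := by
  refine ⟨1, le_rfl, ?_⟩
  set H : E2 → ℝ := fun y => 8 * (‖y‖ ^ 0 * ‖φ₀ y‖ ^ 4) + 128 * (‖y‖ ^ 4 * ‖φ₀ y‖ ^ 4) with hH
  have hH_int : Integrable H :=
    ((φ₀.integrable_pow_mul_norm_pow_four 0).const_mul 8).add
      ((φ₀.integrable_pow_mul_norm_pow_four 4).const_mul 128)
  have hH_nonneg : 0 ≤ ∫ y, H y := integral_nonneg fun y => by positivity
  refine ⟨(∫ y, H y) ^ ((1 : ℝ) / 4) + 1, by positivity, fun N hN => ?_⟩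
  have hterm (k : ℕ) : Integrable fun x : E2 => ((2 : ℝ) ^ (k ^ 2)) ^ 2 *
      H (((2 : ℝ) ^ (k ^ 2)) • (x - ((1 : ℝ) * (k : ℝ) ^ 2) • e1)) :=
    (integrable_comp_smul_sub hH_int (by positivity) _).const_mul _
  have hint : (∫ x : E2, ‖∑ k ∈ Finset.Icc 10 (N - 50), (2 : ℝ) ^ (((k : ℝ) ^ 2) / 2) •
      φ₀ (((2 : ℝ) ^ (k ^ 2)) • (x - ((1 : ℝ) * (k : ℝ) ^ 2) • e1))‖ ^ 4) ≤
      (∫ y, H y) * N := by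
    refine (integral_mono_of_nonneg (Filter.Eventually.of_forall fun x => by positivity)
      (integrable_finsetSum _ fun k _ => hterm k)
      (Filter.Eventually.of_forall fun x => norm_sum_pow_four_le φ₀ _
        (fun k hk => by rw [Finset.mem_Icc] at hk; omega) x)).trans ?_
    rw [integral_finsetSum _ fun k _ => hterm k,
      Finset.sum_congr rfl fun k _ => integral_sq_mul_comp_smul_sub H (by positivity) _,
      Finset.sum_const, nsmul_eq_mul, mul_comm]
    gcongr
    rw [Nat.card_Icc]
    omega
  calc _ ≤ ((∫ y, H y) * N) ^ ((1 : ℝ) / 4) := by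
        refine Real.rpow_le_rpow (integral_nonneg fun x => by positivity) hint (by norm_num)
    _ = (∫ y, H y) ^ ((1 : ℝ) / 4) * (N : ℝ) ^ ((1 : ℝ) / 4) :=
        Real.mul_rpow hH_nonneg N.cast_nonneg
    _ ≤ _ := by gcongr; linarith
end
end

section
/- Let φ₀ be a dyadic partition function, a := (1/√2, 1/√2), e₁ := (1, 0), and for m ∈ ℤ define ψ̂_m(ξ) := 1 − Σ_{r = m−10}^{∞} φ̂₀(2^{−r}(ξ − 2^m a)). There exist constants 0 < c < C, depending only on φ₀, such that for all integers N, n, k with N ≥ 200 and 100 ≤ n ≤ k ≤ N − 50, c · 2^{−5N² + 2n² + 2k²} ≤ ∫_{ℝ²} (ξ₁ξ₂/‖ξ‖²) ψ̂_{n²}(ξ) ∫_{ℝ²} η₁² / ((‖ξ−η‖ + ‖η‖) ‖ξ−η‖³ ‖η‖³) · φ̂₀(2^{−k²}(ξ − η + 2^{N²} e₁)) · φ̂₀(2^{−k²}(η − 2^{N²} e₁)) dη dξ ≤ C · 2^{−5N² + 2n² + 2k²}. -/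
open MeasureTheory Complex
open scoped RealInnerProductSpace ENNReal NNReal

noncomputable section

/-- The resonant kernel integral `∫ G_{n,k,N}`. -/
def Gint (D : DyadicData) (N n k : ℕ) : ℝ :=
  ∫ ξ : E2, (ξ 0 * ξ 1 / ‖ξ‖ ^ 2) * psiHat D ((n : ℤ) ^ 2) ξ *
    ∫ η : E2, (η 0) ^ 2 / ((‖ξ - η‖ + ‖η‖) * ‖ξ - η‖ ^ 3 * ‖η‖ ^ 3) *
      D.Φ ((2 : ℝ) ^ (-((k : ℤ) ^ 2)) • (ξ - η + (2 : ℝ) ^ ((N : ℤ) ^ 2) • e1)) *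
      D.Φ ((2 : ℝ) ^ (-((k : ℤ) ^ 2)) • (η - (2 : ℝ) ^ ((N : ℤ) ^ 2) • e1))

namespace DyadicData

variable (D : DyadicData)

theorem measurable_Φ_s15 : Measurable D.Φ := by
  have hcont : Continuous fun p : E2 × E2 =>
      Complex.exp (-(Complex.I * ((⟪p.2, p.1⟫ : ℝ) : ℂ))) * D.φ p.2 := by
    have := D.φ.continuous
    fun_prop
  have h := hcont.stronglyMeasurable.integral_prod_right' (ν := (volume : Measure E2))
  have hre : D.Φ = fun ξ => (FT (fun x => D.φ x) ξ).re := by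
    funext ξ
    rw [D.hFT, ofReal_re]
  rw [hre]
  exact Complex.measurable_re.comp h.measurable

theorem Φ_zero : D.Φ 0 = 0 := by
  by_contra h
  have := (D.hsupp 0 h).1
  norm_num at this

theorem norm_zpow_smul (m : ℤ) (v : E2) : ‖(2 : ℝ) ^ m • v‖ = (2 : ℝ) ^ m * ‖v‖ := by
  rw [norm_smul, Real.norm_of_nonneg (by positivity)]

theorem Φ_zpow_smul_eq_zero_of_lt {m r : ℤ} {v : E2} (hv : ‖v‖ < (2 : ℝ) ^ (m - 1))
    (hr : m ≤ r) : D.Φ ((2 : ℝ) ^ (-r) • v) = 0 := by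
  by_contra h
  have h1 := (D.hsupp _ h).1
  rw [norm_zpow_smul] at h1
  have h2 : (2 : ℝ) ^ (-r) * ‖v‖ < (2 : ℝ) ^ (-r) * (2 : ℝ) ^ (m - 1) := by gcongr
  have h3 : (2 : ℝ) ^ (-r) * (2 : ℝ) ^ (m - 1) ≤ (2 : ℝ) ^ (-1 : ℤ) := by
    rw [← zpow_add₀ two_ne_zero]
    exact zpow_le_zpow_right₀ one_le_two (by lia)
  rw [show (2 : ℝ) ^ (-1 : ℤ) = 1 / 2 by norm_num] at h3
  linarith

theorem Φ_zpow_smul_eq_zero_of_gt {m r : ℤ} {v : E2} (hv : (2 : ℝ) ^ m < ‖v‖)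
    (hr : r < m) : D.Φ ((2 : ℝ) ^ (-r) • v) = 0 := by
  by_contra h
  have h1 := (D.hsupp _ h).2
  rw [norm_zpow_smul] at h1
  have h2 : (2 : ℝ) ^ (-r) * (2 : ℝ) ^ m < (2 : ℝ) ^ (-r) * ‖v‖ := by gcongr
  have h3 : (2 : ℝ) ^ (1 : ℤ) ≤ (2 : ℝ) ^ (-r) * (2 : ℝ) ^ m := by
    rw [← zpow_add₀ two_ne_zero]
    exact zpow_le_zpow_right₀ one_le_two (by lia)
  rw [zpow_one] at h3
  linarith

theorem injective_shift (m : ℤ) : Function.Injective fun k : ℕ => m + (k : ℤ) :=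
  fun _ _ h => by simpa using h

theorem summable_tail (m : ℤ) (v : E2) :
    Summable fun k : ℕ => D.Φ ((2 : ℝ) ^ (-(m + (k : ℤ))) • v) := by
  by_cases hv : v = 0
  · simp [hv, D.Φ_zero]
  · exact (D.hsum v hv).summable.comp_injective (injective_shift m)

theorem psiHat_nonneg (j : ℤ) (ξ : E2) : 0 ≤ psiHat D j ξ := by
  unfold psiHat
  by_cases hv : ξ - (2 : ℝ) ^ j • aVec = 0
  · simp [hv, D.Φ_zero]
  · have h := D.hsum _ hv
    have := tsum_comp_le_tsum_of_inj h.summable (fun r => D.h0 _) (injective_shift (j - 10))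
    rw [h.tsum_eq] at this
    exact sub_nonneg.2 this

theorem psiHat_le_one (j : ℤ) (ξ : E2) : psiHat D j ξ ≤ 1 :=
  sub_le_self _ (tsum_nonneg fun _ => D.h0 _)

theorem psiHat_eq_one {j : ℤ} {ξ : E2} (h : ‖ξ - (2 : ℝ) ^ j • aVec‖ < (2 : ℝ) ^ (j - 11)) :
    psiHat D j ξ = 1 := by
  have h0 : ∀ k : ℕ, D.Φ ((2 : ℝ) ^ (-(j - 10 + (k : ℤ))) • (ξ - (2 : ℝ) ^ j • aVec)) = 0 :=
    fun k => D.Φ_zpow_smul_eq_zero_of_lt (m := j - 10) (by convert h using 2; ring) (by lia)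
  simp only [psiHat, h0, tsum_zero, sub_zero]

theorem psiHat_eq_zero {j : ℤ} {ξ : E2} (h : (2 : ℝ) ^ (j - 10) < ‖ξ - (2 : ℝ) ^ j • aVec‖) :
    psiHat D j ξ = 0 := by
  have hv : ξ - (2 : ℝ) ^ j • aVec ≠ 0 := norm_pos_iff.1 (lt_trans (by positivity) h)
  have hs := ((injective_shift (j - 10)).hasSum_iff (fun r hr => ?_)).2 (D.hsum _ hv)
  · have := hs.tsum_eq
    simp only [Function.comp_def] at this
    rw [psiHat, this, sub_self]
  · refine D.Φ_zpow_smul_eq_zero_of_gt h ?_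
    by_contra! hlt
    exact hr ⟨(r - (j - 10)).toNat, by simp only; lia⟩

theorem measurable_psiHat (j : ℤ) : Measurable (psiHat D j) := by
  unfold psiHat
  have hΦ := D.measurable_Φ_s15
  refine measurable_const.sub (measurable_of_tendsto_metrizable
    (f := fun n (ξ : E2) => ∑ k ∈ Finset.range n,
      D.Φ ((2 : ℝ) ^ (-(j - 10 + (k : ℤ))) • (ξ - (2 : ℝ) ^ j • aVec))) (fun n => ?_) ?_)
  · fun_prop
  · rw [tendsto_pi_nhds]
    exact fun ξ => (D.summable_tail (j - 10) _).hasSum.tendsto_sum_nat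

end DyadicData

theorem volume_real_ball_E2 (x : E2) {r : ℝ} (hr : 0 ≤ r) :
    (volume : Measure E2).real (Metric.ball x r) = r ^ 2 * Real.pi := by
  simp [Measure.real, EuclideanSpace.volume_ball_fin_two, ENNReal.toReal_ofReal hr, Real.pi_nonneg]

theorem volume_real_closedBall_E2 (x : E2) {r : ℝ} (hr : 0 ≤ r) :
    (volume : Measure E2).real (Metric.closedBall x r) = r ^ 2 * Real.pi := by
  simp [Measure.real, EuclideanSpace.volume_closedBall_fin_two, ENNReal.toReal_ofReal hr, Real.pi_nonneg]

/-- A measurable `f` with `c · 1_{B(y, r)} ≤ f ≤ C · 1_{B(x, R)}` has integral comparable to the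
areas of the two balls. -/
theorem integral_bounds_of_ball_bounds {f : E2 → ℝ} (hf : Measurable f) {x y : E2} {R r c C : ℝ}
    (hR : 0 ≤ R) (hr : 0 ≤ r) (h0 : ∀ z, 0 ≤ f z) (hC : ∀ z, f z ≤ C)
    (hx : ∀ z, R < ‖z - x‖ → f z = 0) (hy : ∀ z, ‖z - y‖ < r → c ≤ f z) :
    c * (r ^ 2 * Real.pi) ≤ ∫ z, f z ∧ ∫ z, f z ≤ C * (R ^ 2 * Real.pi) := by
  have hle : ∀ z, f z ≤ (Metric.closedBall x R).indicator (fun _ => C) z := by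
    intro z
    by_cases hz : z ∈ Metric.closedBall x R
    · simpa [hz] using hC z
    · rw [Set.indicator_of_notMem hz, hx z (by simpa [dist_eq_norm] using hz)]
  have hge : ∀ z, (Metric.ball y r).indicator (fun _ => c) z ≤ f z := by
    intro z
    by_cases hz : z ∈ Metric.ball y r
    · simpa [hz] using hy z (by simpa [dist_eq_norm] using hz)
    · simpa [hz] using h0 z
  have hiC : Integrable ((Metric.closedBall x R).indicator fun _ : E2 => C) :=
    (integrable_indicator_iff measurableSet_closedBall).2
      (integrableOn_const measure_closedBall_lt_top.ne)
  have hic : Integrable ((Metric.ball y r).indicator fun _ : E2 => c) :=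
    (integrable_indicator_iff measurableSet_ball).2 (integrableOn_const measure_ball_lt_top.ne)
  have hif : Integrable f := hiC.mono' hf.aestronglyMeasurable
    (ae_of_all _ fun z => by rw [Real.norm_of_nonneg (h0 z)]; exact hle z)
  constructor
  · have := integral_mono hic hif hge
    rwa [integral_indicator measurableSet_ball, setIntegral_const, volume_real_ball_E2 _ hr,
      smul_eq_mul, mul_comm] at this
  · have := integral_mono hif hiC hle
    rwa [integral_indicator measurableSet_closedBall, setIntegral_const,
      volume_real_closedBall_E2 _ hR, smul_eq_mul, mul_comm] at this

/-- The integrand of the inner integral in `Gint`, with `K = 2^{k²}` and `M = 2^{N²}`. -/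
def innerKernel (D : DyadicData) (k : ℤ) (M : ℝ) (ξ η : E2) : ℝ :=
  (η 0) ^ 2 / ((‖ξ - η‖ + ‖η‖) * ‖ξ - η‖ ^ 3 * ‖η‖ ^ 3) *
    D.Φ ((2 : ℝ) ^ (-k) • (ξ - η + M • e1)) * D.Φ ((2 : ℝ) ^ (-k) • (η - M • e1))

theorem measurable_innerKernel (D : DyadicData) (k : ℤ) (M : ℝ) :
    Measurable (Function.uncurry (innerKernel D k M)) := by
  have hΦ := D.measurable_Φ_s15
  have h0 : Measurable fun p : E2 × E2 => p.2 0 := by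
    have : Continuous fun p : E2 × E2 => p.2 0 := by fun_prop
    exact this.measurable
  unfold innerKernel Function.uncurry
  simp only
  fun_prop

theorem E2_norm_sq (v : E2) : ‖v‖ ^ 2 = v 0 ^ 2 + v 1 ^ 2 := by
  simp [EuclideanSpace.norm_sq_eq, Fin.sum_univ_two]

theorem aVec_apply (i : Fin 2) : aVec i = 1 / Real.sqrt 2 := by
  fin_cases i <;> rfl

theorem one_div_sqrt_two_sq : (1 / Real.sqrt 2) ^ 2 = 1 / 2 := by
  rw [div_pow, Real.sq_sqrt zero_le_two, one_pow]

theorem norm_sq_smul_aVec_add_smul_perp (s t : ℝ) :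
    ‖s • aVec + t • perp aVec‖ ^ 2 = s ^ 2 + t ^ 2 := by
  have h0 : perp aVec 0 = -(1 / Real.sqrt 2) := rfl
  have h1 : perp aVec 1 = 1 / Real.sqrt 2 := rfl
  rw [E2_norm_sq]
  simp only [PiLp.add_apply, PiLp.smul_apply, smul_eq_mul, aVec_apply, h0, h1]
  linear_combination (2 * s ^ 2 + 2 * t ^ 2) * one_div_sqrt_two_sq

/-- Vectors with `aVec`-component at most `K / 2` and orthogonal component `K` have norm close
to `K`. -/
theorem norm_smul_aVec_add_smul_perp_bounds {K s t : ℝ} (hK : 0 < K) (hs : s ^ 2 ≤ K ^ 2 / 4)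
    (ht : t ^ 2 = K ^ 2) :
    K ≤ ‖s • aVec + t • perp aVec‖ ∧ ‖s • aVec + t • perp aVec‖ ≤ 9 / 8 * K := by
  have h := norm_sq_smul_aVec_add_smul_perp s t
  constructor
  · exact le_of_sq_le_sq (by nlinarith) (norm_nonneg _)
  · exact le_of_sq_le_sq (by nlinarith) (by positivity)

theorem weight_bounds {M x p q : ℝ} (hM : 0 < M) (hx : |x - M| ≤ M / 4) (hp : |p - M| ≤ M / 4)
    (hq : |q - M| ≤ M / 4) :
    1 / 20 / M ^ 5 ≤ x ^ 2 / ((p + q) * p ^ 3 * q ^ 3) ∧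
      x ^ 2 / ((p + q) * p ^ 3 * q ^ 3) ≤ 6 / M ^ 5 := by
  rw [abs_le] at hx hp hq
  have hx1 : 3 / 4 * M ≤ x := by linarith
  have hx2 : x ≤ 5 / 4 * M := by linarith
  have hp1 : 3 / 4 * M ≤ p := by linarith
  have hp2 : p ≤ 5 / 4 * M := by linarith
  have hq1 : 3 / 4 * M ≤ q := by linarith
  have hq2 : q ≤ 5 / 4 * M := by linarith
  have hx0 : 0 < x := by linarith
  have hp0 : 0 < p := by linarith
  have hq0 : 0 < q := by linarith
  constructor
  · calc 1 / 20 / M ^ 5 ≤ (3 / 4 * M) ^ 2 /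
          ((5 / 4 * M + 5 / 4 * M) * (5 / 4 * M) ^ 3 * (5 / 4 * M) ^ 3) := by
          rw [div_le_div_iff₀ (by positivity) (by positivity)]
          nlinarith [pow_pos hM 7]
      _ ≤ _ := by gcongr
  · calc x ^ 2 / ((p + q) * p ^ 3 * q ^ 3) ≤ (5 / 4 * M) ^ 2 /
          ((3 / 4 * M + 3 / 4 * M) * (3 / 4 * M) ^ 3 * (3 / 4 * M) ^ 3) := by gcongr
      _ ≤ _ := by
          rw [div_le_div_iff₀ (by positivity) (by positivity)]
          nlinarith [pow_pos hM 7]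

theorem kernel_weight_bounds {M : ℝ} {ξ η : E2} (hM : 0 < M) (h1 : ‖ξ - η + M • e1‖ ≤ M / 4)
    (h2 : ‖η - M • e1‖ ≤ M / 4) :
    1 / 20 / M ^ 5 ≤ (η 0) ^ 2 / ((‖ξ - η‖ + ‖η‖) * ‖ξ - η‖ ^ 3 * ‖η‖ ^ 3) ∧
      (η 0) ^ 2 / ((‖ξ - η‖ + ‖η‖) * ‖ξ - η‖ ^ 3 * ‖η‖ ^ 3) ≤ 6 / M ^ 5 := by
  have he : ‖M • e1‖ = M := by rw [norm_smul, norm_e1, mul_one, Real.norm_of_nonneg hM.le]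
  refine weight_bounds hM ?_ ?_ ?_
  · have h := PiLp.norm_apply_le (η - M • e1) 0
    have h0 : (η - M • e1) 0 = η 0 - M := by simp [e1]
    rw [h0, Real.norm_eq_abs] at h
    exact h.trans h2
  · have h := abs_norm_sub_norm_le (ξ - η) (-(M • e1))
    rw [norm_neg, he, sub_neg_eq_add] at h
    exact h.trans h1
  · have h := abs_norm_sub_norm_le η (M • e1)
    rw [he] at h
    exact h.trans h2

namespace DyadicData

variable (D : DyadicData)

theorem norm_le_of_Φ_ne_zero {k : ℤ} {w : E2} (h : D.Φ ((2 : ℝ) ^ (-k) • w) ≠ 0) :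
    ‖w‖ ≤ 2 * (2 : ℝ) ^ k := by
  have h1 := (D.hsupp _ h).2
  rwa [norm_zpow_smul, zpow_neg, inv_mul_le_iff₀ (by positivity), mul_comm] at h1

theorem Φ_eq_one_of_norm {k : ℤ} {w : E2} (h1 : 7 / 8 * (2 : ℝ) ^ k ≤ ‖w‖)
    (h2 : ‖w‖ ≤ 5 / 4 * (2 : ℝ) ^ k) : D.Φ ((2 : ℝ) ^ (-k) • w) = 1 := by
  apply D.hone <;> rw [norm_zpow_smul, zpow_neg]
  · rwa [le_inv_mul_iff₀ (by positivity), mul_comm]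
  · rwa [inv_mul_le_iff₀ (by positivity), mul_comm]

variable {D}

theorem innerKernel_nonneg (k : ℤ) (M : ℝ) (ξ η : E2) : 0 ≤ innerKernel D k M ξ η :=
  mul_nonneg (mul_nonneg (by positivity) (D.h0 _)) (D.h0 _)

theorem innerKernel_eq_zero {k : ℤ} {M : ℝ} {ξ η : E2}
    (h : 2 * (2 : ℝ) ^ k < ‖η - M • e1‖) : innerKernel D k M ξ η = 0 := by
  by_contra hne
  exact h.not_ge (D.norm_le_of_Φ_ne_zero (right_ne_zero_of_mul hne))

theorem innerKernel_le {k : ℤ} {M : ℝ} (hM : 0 < M) (hk : 8 * (2 : ℝ) ^ k ≤ M) (ξ η : E2) :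
    innerKernel D k M ξ η ≤ 6 / M ^ 5 := by
  by_cases hne : innerKernel D k M ξ η = 0
  · rw [hne]
    positivity
  · have h1 := D.norm_le_of_Φ_ne_zero (right_ne_zero_of_mul (left_ne_zero_of_mul hne))
    have h2 := D.norm_le_of_Φ_ne_zero (right_ne_zero_of_mul hne)
    have hw := (kernel_weight_bounds (ξ := ξ) (η := η) hM (by linarith) (by linarith)).2
    refine le_trans ?_ hw
    exact (mul_le_of_le_one_right (mul_nonneg (by positivity) (D.h0 _)) (D.h1 _)).trans
      (mul_le_of_le_one_right (by positivity) (D.h1 _))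

theorem le_innerKernel {k : ℤ} {M A : ℝ} {ξ η : E2} (hM : 0 < M) (hk : 8 * (2 : ℝ) ^ k ≤ M)
    (hA : 0 < A) (hAK : A ≤ (2 : ℝ) ^ k) (hξ : ‖ξ - A • aVec‖ < A / 2048)
    (hη : ‖η - (M • e1 + ((A / 2) • aVec + (2 : ℝ) ^ k • perp aVec))‖ < (2 : ℝ) ^ k / 32) :
    1 / 20 / M ^ 5 ≤ innerKernel D k M ξ η := by
  set K : ℝ := (2 : ℝ) ^ k with hKdef
  have hK : 0 < K := by positivity
  obtain ⟨hc1, hc2⟩ := norm_smul_aVec_add_smul_perp_bounds (s := A / 2) (t := K) hK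
    (by nlinarith) rfl
  obtain ⟨hd1, hd2⟩ := norm_smul_aVec_add_smul_perp_bounds (s := A / 2) (t := -K) hK
    (by nlinarith) (by ring)
  set u := η - (M • e1 + ((A / 2) • aVec + K • perp aVec)) with hu
  set v := ξ - A • aVec with hv
  have hη' : ‖η - M • e1 - ((A / 2) • aVec + K • perp aVec)‖ ≤ K / 32 := by
    rw [show η - M • e1 - ((A / 2) • aVec + K • perp aVec) = u by rw [hu]; module]
    exact hη.le
  have hξη : ‖ξ - η + M • e1 - ((A / 2) • aVec + (-K) • perp aVec)‖ ≤ K / 16 := by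
    rw [show ξ - η + M • e1 - ((A / 2) • aVec + (-K) • perp aVec) = v - u by
      rw [hu, hv]; module]
    linarith [norm_sub_le v u]
  have e1' := abs_le.1 ((abs_norm_sub_norm_le _ _).trans hη')
  have e2' := abs_le.1 ((abs_norm_sub_norm_le _ _).trans hξη)
  have hw := (kernel_weight_bounds (ξ := ξ) (η := η) hM (by linarith) (by linarith)).1
  rw [innerKernel, D.Φ_eq_one_of_norm (by linarith) (by linarith),
    D.Φ_eq_one_of_norm (by linarith) (by linarith), mul_one, mul_one]
  exact hw

theorem integral_innerKernel_bounds {k : ℤ} {M : ℝ} (hM : 0 < M) (hk : 8 * (2 : ℝ) ^ k ≤ M)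
    (ξ : E2) :
    0 ≤ ∫ η, innerKernel D k M ξ η ∧
      (∫ η, innerKernel D k M ξ η) ≤ 6 / M ^ 5 * ((2 * (2 : ℝ) ^ k) ^ 2 * Real.pi) :=
  ⟨integral_nonneg (innerKernel_nonneg k M ξ),
    (integral_bounds_of_ball_bounds (y := 0) (r := 0) (c := 0)
      ((measurable_innerKernel D k M).of_uncurry_left) (by positivity) le_rfl
      (innerKernel_nonneg k M ξ) (innerKernel_le hM hk ξ) (fun _ => innerKernel_eq_zero)
      (fun _ _ => innerKernel_nonneg k M ξ _)).2⟩

theorem le_integral_innerKernel {k : ℤ} {M A : ℝ} {ξ : E2} (hM : 0 < M)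
    (hk : 8 * (2 : ℝ) ^ k ≤ M) (hA : 0 < A) (hAK : A ≤ (2 : ℝ) ^ k)
    (hξ : ‖ξ - A • aVec‖ < A / 2048) :
    1 / 20 / M ^ 5 * (((2 : ℝ) ^ k / 32) ^ 2 * Real.pi) ≤ ∫ η, innerKernel D k M ξ η :=
  (integral_bounds_of_ball_bounds ((measurable_innerKernel D k M).of_uncurry_left)
    (by positivity) (by positivity) (innerKernel_nonneg k M ξ) (innerKernel_le hM hk ξ)
    (fun _ => innerKernel_eq_zero) (fun _ => le_innerKernel hM hk hA hAK hξ)).1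

end DyadicData

theorem angular_le_one (ξ : E2) : ξ 0 * ξ 1 / ‖ξ‖ ^ 2 ≤ 1 := by
  refine div_le_one_of_le₀ ?_ (by positivity)
  rw [E2_norm_sq]
  nlinarith [sq_nonneg (ξ 0 - ξ 1), sq_nonneg (ξ 0 + ξ 1)]

theorem le_angular {A : ℝ} {ξ : E2} (hA : 0 < A) (h : ‖ξ - A • aVec‖ ≤ A / 1024) :
    1 / 16 ≤ ξ 0 * ξ 1 / ‖ξ‖ ^ 2 := by
  have hs : 7 / 10 ≤ 1 / Real.sqrt 2 :=
    le_of_sq_le_sq (by rw [one_div_sqrt_two_sq]; norm_num) (by positivity)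
  have hcoord : ∀ i, A / 2 ≤ ξ i := by
    intro i
    have h1 := (PiLp.norm_apply_le (ξ - A • aVec) i).trans h
    have h2 : (ξ - A • aVec) i = ξ i - A * (1 / Real.sqrt 2) := by simp [aVec_apply]
    rw [h2, Real.norm_eq_abs, abs_le] at h1
    nlinarith [h1.1]
  have ha : ‖A • aVec‖ = A := by rw [norm_smul, norm_aVec, mul_one, Real.norm_of_nonneg hA.le]
  have hle : ‖ξ‖ ≤ 2 * A := by
    have := norm_sub_norm_le ξ (A • aVec)
    linarith
  have hsq : ‖ξ‖ ^ 2 ≤ 4 * A ^ 2 := by nlinarith [norm_nonneg ξ]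
  have hpos : 0 < ‖ξ‖ ^ 2 := by
    rw [E2_norm_sq]
    nlinarith [hcoord 0, hcoord 1]
  rw [le_div_iff₀ hpos]
  nlinarith [mul_le_mul (hcoord 0) (hcoord 1) (by positivity) (by linarith [hcoord 0])]

theorem Gint_eq (D : DyadicData) (N n k : ℕ) :
    Gint D N n k = ∫ ξ : E2, (ξ 0 * ξ 1 / ‖ξ‖ ^ 2) * psiHat D ((n : ℤ) ^ 2) ξ *
      ∫ η, innerKernel D ((k : ℤ) ^ 2) ((2 : ℝ) ^ ((N : ℤ) ^ 2)) ξ η :=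
  rfl

/-- Two-sided bound for the double integral with low frequency `2^j`, annulus radius `2^k` and
high frequency `M`. -/
theorem integral_kernel_bounds (D : DyadicData) {j k : ℤ} {M : ℝ} (hM : 0 < M)
    (hk : 8 * (2 : ℝ) ^ k ≤ M) (hjk : j ≤ k) :
    1 / 16 * (1 / 20 / M ^ 5 * (((2 : ℝ) ^ k / 32) ^ 2 * Real.pi)) *
        (((2 : ℝ) ^ j / 2048) ^ 2 * Real.pi) ≤
      ∫ ξ : E2, (ξ 0 * ξ 1 / ‖ξ‖ ^ 2) * psiHat D j ξ * ∫ η, innerKernel D k M ξ η ∧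
    ∫ ξ : E2, (ξ 0 * ξ 1 / ‖ξ‖ ^ 2) * psiHat D j ξ * ∫ η, innerKernel D k M ξ η ≤
      6 / M ^ 5 * ((2 * (2 : ℝ) ^ k) ^ 2 * Real.pi) * (((2 : ℝ) ^ j / 1024) ^ 2 * Real.pi) := by
  have h10 : (2 : ℝ) ^ (j - 10) = (2 : ℝ) ^ j / 1024 := by
    rw [zpow_sub₀ two_ne_zero]; norm_num
  have h11 : (2 : ℝ) ^ (j - 11) = (2 : ℝ) ^ j / 2048 := by
    rw [zpow_sub₀ two_ne_zero]; norm_num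
  have hA : (0 : ℝ) < (2 : ℝ) ^ j := by positivity
  have hAK : (2 : ℝ) ^ j ≤ (2 : ℝ) ^ k := zpow_le_zpow_right₀ one_le_two hjk
  have hψ := D.measurable_psiHat j
  have hF : Measurable fun ξ : E2 => ∫ η, innerKernel D k M ξ η :=
    (measurable_innerKernel D k M).stronglyMeasurable.integral_prod_right.measurable
  have hang : Measurable fun ξ : E2 => ξ 0 * ξ 1 / ‖ξ‖ ^ 2 := by
    have h0 : Continuous fun ξ : E2 => ξ 0 * ξ 1 := by fun_prop
    exact h0.measurable.div (measurable_norm.pow_const 2)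
  have hout : ∀ ξ, (2 : ℝ) ^ j / 1024 < ‖ξ - (2 : ℝ) ^ j • aVec‖ → psiHat D j ξ = 0 :=
    fun ξ h => D.psiHat_eq_zero (h10 ▸ h)
  have hin : ∀ ξ, ‖ξ - (2 : ℝ) ^ j • aVec‖ < (2 : ℝ) ^ j / 2048 → psiHat D j ξ = 1 :=
    fun ξ h => D.psiHat_eq_one (h11 ▸ h)
  have hsymbol : ∀ ξ : E2, 0 ≤ (ξ 0 * ξ 1 / ‖ξ‖ ^ 2) * psiHat D j ξ := by
    intro ξ
    by_cases hξ : (2 : ℝ) ^ j / 1024 < ‖ξ - (2 : ℝ) ^ j • aVec‖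
    · rw [hout ξ hξ, mul_zero]
    · exact mul_nonneg (le_trans (by norm_num) (le_angular hA (not_lt.1 hξ)))
        (D.psiHat_nonneg j ξ)
  refine integral_bounds_of_ball_bounds
    (f := fun ξ => (ξ 0 * ξ 1 / ‖ξ‖ ^ 2) * psiHat D j ξ * ∫ η, innerKernel D k M ξ η)
    ((hang.mul hψ).mul hF) (x := (2 : ℝ) ^ j • aVec)
    (y := (2 : ℝ) ^ j • aVec) (by positivity) (by positivity) ?_ ?_ ?_ ?_
  · exact fun ξ => mul_nonneg (hsymbol ξ) (DyadicData.integral_innerKernel_bounds hM hk ξ).1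
  · intro ξ
    obtain ⟨hF0, hF1⟩ := DyadicData.integral_innerKernel_bounds (D := D) hM hk ξ
    refine (mul_le_of_le_one_left hF0 ?_).trans hF1
    exact (mul_le_of_le_one_left (D.psiHat_nonneg j ξ) (angular_le_one ξ)).trans
      (D.psiHat_le_one j ξ)
  · intro ξ hξ
    simp only [hout ξ hξ, mul_zero, zero_mul]
  · intro ξ hξ
    simp only [hin ξ hξ, mul_one]
    exact mul_le_mul (le_angular hA (by linarith))
      (DyadicData.le_integral_innerKernel hM hk hA hAK hξ) (by positivity)
      (le_trans (by norm_num) (le_angular hA (by linarith)))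

theorem zpow_two_resonant_eq (a b c : ℤ) :
    (2 : ℝ) ^ (-5 * a + 2 * b + 2 * c) =
      ((2 : ℝ) ^ b) ^ 2 * ((2 : ℝ) ^ c) ^ 2 / ((2 : ℝ) ^ a) ^ 5 := by
  have h2 : (2 : ℝ) ≠ 0 := two_ne_zero
  rw [zpow_add₀ h2, zpow_add₀ h2, mul_comm (-5 : ℤ), mul_comm 2 b, mul_comm 2 c, zpow_mul,
    zpow_mul, zpow_mul]
  rw [zpow_neg]
  norm_cast
  ring

/-- the two-sided bound `∫ G_{n,k,N} ≍ 2^{−5N²+2n²+2k²}`. -/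
theorem stmt15 (D : DyadicData) :
    ∃ c C : ℝ, 0 < c ∧ c < C ∧
      ∀ N n k : ℕ, 200 ≤ N → 100 ≤ n → n ≤ k → k ≤ N - 50 →
        c * (2 : ℝ) ^ (-5 * (N : ℤ) ^ 2 + 2 * (n : ℤ) ^ 2 + 2 * (k : ℤ) ^ 2) ≤
            Gint D N n k ∧
          Gint D N n k ≤
            C * (2 : ℝ) ^ (-5 * (N : ℤ) ^ 2 + 2 * (n : ℤ) ^ 2 + 2 * (k : ℤ) ^ 2) := by
  have hpi := Real.pi_pos
  refine ⟨Real.pi ^ 2 / 2 ^ 42, Real.pi ^ 2, by positivity,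
    div_lt_self (by positivity) (by norm_num), ?_⟩
  intro N n k hN _ hnk hkN
  have hkN' : (k : ℤ) ≤ N - 50 := by lia
  have hjk : (n : ℤ) ^ 2 ≤ (k : ℤ) ^ 2 := by
    have : (n : ℤ) ≤ k := by exact_mod_cast hnk
    gcongr
  have hK : 8 * (2 : ℝ) ^ ((k : ℤ) ^ 2) ≤ (2 : ℝ) ^ ((N : ℤ) ^ 2) := by
    rw [show (8 : ℝ) = (2 : ℝ) ^ (3 : ℤ) by norm_num, ← zpow_add₀ two_ne_zero]
    exact zpow_le_zpow_right₀ one_le_two (by nlinarith)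
  obtain ⟨h1, h2⟩ := integral_kernel_bounds D (M := (2 : ℝ) ^ ((N : ℤ) ^ 2)) (by positivity) hK hjk
  rw [Gint_eq, zpow_two_resonant_eq]
  set A : ℝ := (2 : ℝ) ^ ((n : ℤ) ^ 2)
  set K : ℝ := (2 : ℝ) ^ ((k : ℤ) ^ 2)
  set M : ℝ := (2 : ℝ) ^ ((N : ℤ) ^ 2)
  have hX : 0 ≤ Real.pi ^ 2 * (A ^ 2 * K ^ 2 / M ^ 5) := by positivity
  refine ⟨le_trans ?_ h1, h2.trans ?_⟩
  · calc Real.pi ^ 2 / 2 ^ 42 * (A ^ 2 * K ^ 2 / M ^ 5)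
        = 1 / 2 ^ 42 * (Real.pi ^ 2 * (A ^ 2 * K ^ 2 / M ^ 5)) := by ring
      _ ≤ 1 / (320 * 2 ^ 32) * (Real.pi ^ 2 * (A ^ 2 * K ^ 2 / M ^ 5)) := by
        gcongr
        norm_num
      _ = _ := by ring
  · calc 6 / M ^ 5 * ((2 * K) ^ 2 * Real.pi) * ((A / 1024) ^ 2 * Real.pi)
        = 24 / 2 ^ 20 * (Real.pi ^ 2 * (A ^ 2 * K ^ 2 / M ^ 5)) := by ring
      _ ≤ 1 * (Real.pi ^ 2 * (A ^ 2 * K ^ 2 / M ^ 5)) := by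
        gcongr
        norm_num
      _ = _ := by ring
end
end

section
/- Let φ₀ be a dyadic partition function, a := (1/√2, 1/√2), e₁ := (1, 0), and for m ∈ ℤ define ψ̂_m(ξ) := 1 − Σ_{r = m−10}^{∞} φ̂₀(2^{−r}(ξ − 2^m a)). There exists a constant C > 0, depending only on φ₀, such that for all integers N, n, ℓ with N ≥ 200, 100 ≤ n ≤ N − 50, 10 ≤ ℓ ≤ n − 1, and every real number b, ∫_{ℝ²} | (ξ₁ξ₂/‖ξ‖²) ψ̂_{n²}(ξ) ∫_{ℝ²} e^{i b η₁} η₁² / ((‖ξ−η‖ + ‖η‖) ‖ξ−η‖³ ‖η‖³) · φ̂₀(2^{−n²}(ξ − η + 2^{N²} e₁)) · φ̂₀(2^{−ℓ²}(η − 2^{N²} e₁)) dη | dξ ≤ C · 2^{−5N²} · 2^{2(n² + ℓ²)}. -/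
open MeasureTheory Complex
open scoped RealInnerProductSpace ENNReal NNReal

noncomputable section

/-- The norm of an integral is at most the sup of the norm times the volume of a disc containing
the support. -/
theorem norm_integral_le_of_closedBall {F : Type*} [NormedAddCommGroup F] [NormedSpace ℝ F]
    {f : E2 → F} {A r : ℝ} (c : E2) (hr : 0 ≤ r)
    (hA : ∀ x, ‖x - c‖ ≤ r → ‖f x‖ ≤ A) (h0 : ∀ x, r < ‖x - c‖ → f x = 0) :
    ‖∫ x, f x‖ ≤ A * (r ^ 2 * (volume : Measure E2).real (Metric.ball 0 1)) := by
  have h : ∫ x in Metric.closedBall c r, f x = ∫ x, f x :=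
    setIntegral_eq_integral_of_forall_compl_eq_zero fun x hx => h0 x (by
      simpa [Metric.mem_closedBall, dist_eq_norm] using hx)
  have hvol : (volume : Measure E2).real (Metric.closedBall c r) =
      r ^ 2 * (volume : Measure E2).real (Metric.ball 0 1) := by
    simpa using Measure.addHaar_real_closedBall (volume : Measure E2) c hr
  rw [← h, ← hvol]
  exact norm_setIntegral_le_of_norm_le_const measure_closedBall_lt_top fun x hx =>
    hA x (by simpa [Metric.mem_closedBall, dist_eq_norm] using hx)

namespace DyadicData

theorem norm_le_of_ne_zero (D : DyadicData) {k : ℤ} {x : E2}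
    (h : D.Φ ((2 : ℝ) ^ (-k) • x) ≠ 0) : ‖x‖ ≤ 2 * (2 : ℝ) ^ k := by
  have h2 := (D.hsupp _ h).2
  have hk : (0 : ℝ) < 2 ^ k := by positivity
  rw [norm_smul, Real.norm_of_nonneg (by positivity), zpow_neg, inv_mul_le_iff₀ hk] at h2
  linarith

theorem apply_zero (D : DyadicData) : D.Φ 0 = 0 := by
  by_contra h
  have := (D.hsupp 0 h).1
  norm_num at this

theorem abs_psiHat_le_one (D : DyadicData) (j : ℤ) (ξ : E2) : |psiHat D j ξ| ≤ 1 := by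
  unfold psiHat
  set x := ξ - (2 : ℝ) ^ j • aVec
  set S := ∑' k : ℕ, D.Φ ((2 : ℝ) ^ (-(j - 10 + (k : ℤ))) • x) with hS
  have hS0 : 0 ≤ S := tsum_nonneg fun k => D.h0 _
  have hS1 : S ≤ 1 := by
    by_cases hx : x = 0
    · simp [hS, hx, D.apply_zero]
    · have hsum := D.hsum x hx
      have hinj : Function.Injective fun k : ℕ => j - 10 + (k : ℤ) := fun a b hab => by
        simpa using hab
      rw [← hsum.tsum_eq]
      exact (hsum.summable.comp_injective hinj).tsum_le_tsum_of_inj _ hinj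
        (fun _ _ => D.h0 _) (fun _ => le_rfl) hsum.summable
  rw [abs_le]
  constructor <;> linarith

end DyadicData

theorem abs_coord_le_norm (x : E2) (i : Fin 2) : |x i| ≤ ‖x‖ := by
  simpa using PiLp.norm_apply_le x i

theorem abs_coord_mul_div_le_one (x : E2) : |x 0 * x 1 / ‖x‖ ^ 2| ≤ 1 := by
  rw [abs_div, abs_mul, abs_of_nonneg (sq_nonneg ‖x‖)]
  refine div_le_one_of_le₀ ?_ (by positivity)
  rw [sq]
  exact mul_le_mul (abs_coord_le_norm x 0) (abs_coord_le_norm x 1) (abs_nonneg _) (norm_nonneg _)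

/-- Pointwise bound for the singular weight when both frequencies are at distance at least `M / 2`
from the origin. -/
theorem abs_weight_le {M : ℝ} (hM : 0 < M) {x y : E2} (hx : M / 2 ≤ ‖x‖) (hy : M / 2 ≤ ‖y‖) :
    |(y 0) ^ 2 / ((‖x‖ + ‖y‖) * ‖x‖ ^ 3 * ‖y‖ ^ 3)| ≤ 16 * (M ^ 5)⁻¹ := by
  have hx0 : 0 < ‖x‖ := by linarith
  have hy0 : 0 < ‖y‖ := by linarith
  have hy2 : (y 0) ^ 2 ≤ ‖y‖ ^ 2 := sq_le_sq.mpr (by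
    simpa using abs_coord_le_norm y 0)
  rw [abs_of_nonneg (by positivity)]
  have hden : M * (M / 2) ^ 3 * (M / 2) ≤ (‖x‖ + ‖y‖) * ‖x‖ ^ 3 * ‖y‖ := by
    gcongr
    linarith
  calc (y 0) ^ 2 / ((‖x‖ + ‖y‖) * ‖x‖ ^ 3 * ‖y‖ ^ 3)
      ≤ ‖y‖ ^ 2 / ((‖x‖ + ‖y‖) * ‖x‖ ^ 3 * ‖y‖ ^ 3) := by gcongr
    _ = 1 / ((‖x‖ + ‖y‖) * ‖x‖ ^ 3 * ‖y‖) := by field_simp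
    _ ≤ 1 / (M * (M / 2) ^ 3 * (M / 2)) := one_div_le_one_div_of_le (by positivity) hden
    _ = 16 * (M ^ 5)⁻¹ := by field_simp; norm_num

/-- `L¹_ξ` bound for the oscillatory off-diagonal kernel
`H_{n,n,ℓ,N}` with phase `b`. -/
theorem stmt16 (D : DyadicData) :
    ∃ C : ℝ, 0 < C ∧
      ∀ N n l : ℕ, 200 ≤ N → 100 ≤ n → n ≤ N - 50 → 10 ≤ l → l ≤ n - 1 →
        ∀ b : ℝ,
        (∫ ξ : E2, ‖((ξ 0 * ξ 1 / ‖ξ‖ ^ 2 * psiHat D ((n : ℤ) ^ 2) ξ : ℝ) : ℂ) *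
            ∫ η : E2, Complex.exp (Complex.I * ((b * η 0 : ℝ) : ℂ)) *
              (((η 0) ^ 2 / ((‖ξ - η‖ + ‖η‖) * ‖ξ - η‖ ^ 3 * ‖η‖ ^ 3) *
                D.Φ ((2 : ℝ) ^ (-((n : ℤ) ^ 2)) •
                  (ξ - η + (2 : ℝ) ^ ((N : ℤ) ^ 2) • e1)) *
                D.Φ ((2 : ℝ) ^ (-((l : ℤ) ^ 2)) •
                  (η - (2 : ℝ) ^ ((N : ℤ) ^ 2) • e1)) : ℝ) : ℂ)‖) ≤
          C * (2 : ℝ) ^ (-5 * (N : ℤ) ^ 2) * (2 : ℝ) ^ (2 * ((n : ℤ) ^ 2 + (l : ℤ) ^ 2)) := by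
  set V := (volume : Measure E2).real (Metric.ball 0 1) with hV
  have hV0 : 0 ≤ V := measureReal_nonneg
  refine ⟨1024 * V ^ 2 + 1, by positivity, fun N n l hN hn hnN hl hln b => ?_⟩
  set M : ℝ := (2 : ℝ) ^ ((N : ℤ) ^ 2) with hM
  set K : ℝ := (2 : ℝ) ^ ((n : ℤ) ^ 2) with hK
  set L : ℝ := (2 : ℝ) ^ ((l : ℤ) ^ 2) with hL
  have hM0 : 0 < M := by positivity
  have hK0 : 0 < K := by positivity
  have hL0 : 0 < L := by positivity
  have hLK : L ≤ K := by
    refine zpow_le_zpow_right₀ (by norm_num) ?_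
    have : (l : ℤ) ≤ n := by omega
    gcongr
  have hKM : K * 8 ≤ M := by
    have h8 : K * 8 = (2 : ℝ) ^ ((n : ℤ) ^ 2 + 3) := by
      rw [zpow_add₀ two_ne_zero]; norm_num [hK]
    rw [h8]
    refine zpow_le_zpow_right₀ (by norm_num) ?_
    have : (n : ℤ) + 50 ≤ N := by omega
    nlinarith
  have he : ‖M • e1‖ = M := by
    simp [norm_smul, e1, abs_of_pos hM0]
  have hfinal : (2 : ℝ) ^ (-5 * (N : ℤ) ^ 2) * (2 : ℝ) ^ (2 * ((n : ℤ) ^ 2 + (l : ℤ) ^ 2)) =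
      (M ^ 5)⁻¹ * (K ^ 2 * L ^ 2) := by
    simp only [hM, hK, hL, ← zpow_natCast, ← zpow_mul, ← zpow_neg]
    rw [← zpow_add₀ two_ne_zero, ← zpow_add₀ two_ne_zero, ← zpow_add₀ two_ne_zero]
    congr 1
    push_cast
    ring
  have hright : ∀ ξ η : E2, D.Φ ((2 : ℝ) ^ (-((n : ℤ) ^ 2)) • (ξ - η + M • e1)) ≠ 0 →
      ‖ξ - η + M • e1‖ ≤ 2 * K := fun ξ η h => D.norm_le_of_ne_zero h
  have hleft : ∀ η : E2, D.Φ ((2 : ℝ) ^ (-((l : ℤ) ^ 2)) • (η - M • e1)) ≠ 0 →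
      ‖η - M • e1‖ ≤ 2 * L := fun η h => D.norm_le_of_ne_zero h
  have hinner : ∀ ξ : E2, ‖∫ η : E2, Complex.exp (Complex.I * ((b * η 0 : ℝ) : ℂ)) *
      (((η 0) ^ 2 / ((‖ξ - η‖ + ‖η‖) * ‖ξ - η‖ ^ 3 * ‖η‖ ^ 3) *
        D.Φ ((2 : ℝ) ^ (-((n : ℤ) ^ 2)) • (ξ - η + M • e1)) *
        D.Φ ((2 : ℝ) ^ (-((l : ℤ) ^ 2)) • (η - M • e1)) : ℝ) : ℂ)‖ ≤
      16 * (M ^ 5)⁻¹ * ((2 * L) ^ 2 * V) := by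
    intro ξ
    refine norm_integral_le_of_closedBall (M • e1) (by positivity) (fun η hη => ?_)
      (fun η hη => ?_)
    · rw [norm_mul, mul_comm Complex.I, Complex.norm_exp_ofReal_mul_I, one_mul,
        Complex.norm_real, Real.norm_eq_abs, abs_mul, abs_mul, abs_of_nonneg (D.h0 _),
        abs_of_nonneg (D.h0 _)]
      by_cases h : D.Φ ((2 : ℝ) ^ (-((n : ℤ) ^ 2)) • (ξ - η + M • e1)) = 0
      · rw [h, mul_zero, zero_mul]
        positivity
      · have h1 := hright ξ η h
        have hx : M / 2 ≤ ‖ξ - η‖ := by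
          have := norm_sub_le (ξ - η + M • e1) (ξ - η)
          rw [add_sub_cancel_left, he] at this
          linarith
        have hy : M / 2 ≤ ‖η‖ := by
          have := norm_sub_le η (η - M • e1)
          rw [sub_sub_cancel, he] at this
          linarith
        exact (mul_le_of_le_one_right (mul_nonneg (abs_nonneg _) (D.h0 _)) (D.h1 _)).trans
          ((mul_le_of_le_one_right (abs_nonneg _) (D.h1 _)).trans (abs_weight_le hM0 hx hy))
    · have h : D.Φ ((2 : ℝ) ^ (-((l : ℤ) ^ 2)) • (η - M • e1)) = 0 := by
        by_contra h
        exact hη.not_ge (hleft η h)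
      rw [h, mul_zero, Complex.ofReal_zero, mul_zero]
  rw [mul_assoc, hfinal]
  refine (Real.le_norm_self _).trans ((norm_integral_le_of_closedBall
    (A := 16 * (M ^ 5)⁻¹ * ((2 * L) ^ 2 * V)) (r := 4 * K) 0 (by positivity) (fun ξ _ => ?_)
    (fun ξ hξ => ?_)).trans ?_)
  · rw [norm_norm, norm_mul, Complex.norm_real, Real.norm_eq_abs, abs_mul]
    refine (mul_le_of_le_one_left (norm_nonneg _) ?_).trans (hinner ξ)
    exact mul_le_one₀ (abs_coord_mul_div_le_one ξ) (abs_nonneg _) (D.abs_psiHat_le_one _ ξ)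
  · rw [sub_zero] at hξ
    have h : ∀ η : E2, D.Φ ((2 : ℝ) ^ (-((n : ℤ) ^ 2)) • (ξ - η + M • e1)) *
        D.Φ ((2 : ℝ) ^ (-((l : ℤ) ^ 2)) • (η - M • e1)) = 0 := by
      intro η
      by_contra h
      have h1 := hright ξ η (left_ne_zero_of_mul h)
      have h2 := hleft η (right_ne_zero_of_mul h)
      have h3 := norm_add_le (ξ - η + M • e1) (η - M • e1)
      rw [show ξ - η + M • e1 + (η - M • e1) = ξ by abel] at h3
      linarith
    simp only [mul_assoc _ (D.Φ _) (D.Φ _), h]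
    simp
  · have hP : 0 ≤ (M ^ 5)⁻¹ * (K ^ 2 * L ^ 2) := by positivity
    rw [← hV]
    linarith
end
end

section
/- Let r > 0, let G : ℝ² → ℝ be integrable with G ≥ 0 and G(ξ) = 0 whenever ‖ξ‖ > r, and let ε ∈ (0, 1/2]. Then ( ∫_{‖y‖ ≤ ε/r} | ∫_{ℝ²} e^{i y·ξ} G(ξ) dξ |⁴ dy )^{1/4} ≥ (1 − ε) π^{1/4} (ε/r)^{1/2} ∫_{ℝ²} G(ξ) dξ. -/
open MeasureTheory Complex
open scoped RealInnerProductSpace ENNReal NNReal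

noncomputable section

/-- The inverse Fourier integral of an integrable function is continuous. -/
theorem continuous_integral_exp_inner_mul {G : E2 → ℝ} (hG : Integrable G) :
    Continuous fun y : E2 =>
      ∫ ξ : E2, Complex.exp (Complex.I * ((⟪y, ξ⟫ : ℝ) : ℂ)) * ((G ξ : ℝ) : ℂ) := by
  refine continuous_of_dominated (bound := fun ξ => ‖G ξ‖) (fun y => ?_) (fun y => ?_)
    hG.norm ?_
  · exact (by fun_prop : Continuous fun ξ : E2 =>
      Complex.exp (Complex.I * ((⟪y, ξ⟫ : ℝ) : ℂ))).aestronglyMeasurable.mul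
      hG.ofReal.aestronglyMeasurable
  · refine .of_forall fun ξ => ?_
    rw [norm_mul, Complex.norm_exp_I_mul_ofReal, one_mul, Complex.norm_real]
  · exact .of_forall fun ξ => by fun_prop

/-- Near the origin, the inverse Fourier integral of a nonnegative compactly supported function
is almost as large as the integral of the function. -/
theorem one_sub_mul_integral_le_norm_integral_exp_inner_mul {r : ℝ} (hr : 0 < r) {G : E2 → ℝ}
    (hG : Integrable G) (hG0 : ∀ ξ, 0 ≤ G ξ) (hGsupp : ∀ ξ, r < ‖ξ‖ → G ξ = 0)
    {ε : ℝ} {y : E2} (hy : ‖y‖ ≤ ε / r) :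
    (1 - ε) * ∫ ξ, G ξ ≤
      ‖∫ ξ : E2, Complex.exp (Complex.I * ((⟪y, ξ⟫ : ℝ) : ℂ)) * ((G ξ : ℝ) : ℂ)‖ := by
  have hint : Integrable fun ξ : E2 =>
      Complex.exp (Complex.I * ((⟪y, ξ⟫ : ℝ) : ℂ)) * ((G ξ : ℝ) : ℂ) := by
    refine hG.ofReal.bdd_mul (c := 1) (by fun_prop) (.of_forall fun ξ => ?_)
    rw [Complex.norm_exp_I_mul_ofReal]
  have hGC : Integrable fun ξ : E2 => ((G ξ : ℝ) : ℂ) := hG.ofReal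
  have hdiff : ‖(∫ ξ : E2, Complex.exp (Complex.I * ((⟪y, ξ⟫ : ℝ) : ℂ)) * ((G ξ : ℝ) : ℂ)) -
      ((∫ ξ, G ξ : ℝ) : ℂ)‖ ≤ ε * ∫ ξ, G ξ := by
    rw [← integral_complex_ofReal, ← integral_sub hint hGC, ← integral_const_mul]
    refine norm_integral_le_of_norm_le (hG.const_mul ε) (.of_forall fun ξ => ?_)
    rcases lt_or_ge r ‖ξ‖ with hξ | hξ
    · simp [hGsupp ξ hξ]
    · rw [← sub_one_mul, norm_mul, Complex.norm_real, Real.norm_of_nonneg (hG0 ξ)]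
      refine mul_le_mul_of_nonneg_right ?_ (hG0 ξ)
      calc ‖Complex.exp (Complex.I * ((⟪y, ξ⟫ : ℝ) : ℂ)) - 1‖
          ≤ ‖(⟪y, ξ⟫ : ℝ)‖ := Real.norm_exp_I_mul_ofReal_sub_one_le
        _ ≤ ‖y‖ * ‖ξ‖ := norm_inner_le_norm y ξ
        _ ≤ ε / r * r := mul_le_mul hy hξ (norm_nonneg _) ((norm_nonneg _).trans hy)
        _ = ε := div_mul_cancel₀ ε hr.ne'
  have htri := norm_sub_norm_le ((∫ ξ, G ξ : ℝ) : ℂ)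
    (∫ ξ : E2, Complex.exp (Complex.I * ((⟪y, ξ⟫ : ℝ) : ℂ)) * ((G ξ : ℝ) : ℂ))
  rw [norm_sub_rev, Complex.norm_real, Real.norm_of_nonneg (integral_nonneg hG0)] at htri
  linarith

/-- quantitative local `L⁴` lower bound for the inverse Fourier
transform of a nonnegative compactly supported function. -/
theorem stmt17 (r : ℝ) (hr : 0 < r) (G : E2 → ℝ) (hG : Integrable G)
    (hG0 : ∀ ξ : E2, 0 ≤ G ξ) (hGsupp : ∀ ξ : E2, r < ‖ξ‖ → G ξ = 0)
    (ε : ℝ) (hε0 : 0 < ε) (hε : ε ≤ 1 / 2) :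
    (1 - ε) * Real.pi ^ ((1 : ℝ) / 4) * (ε / r) ^ ((1 : ℝ) / 2) * (∫ ξ : E2, G ξ) ≤
      (∫ y in {y : E2 | ‖y‖ ≤ ε / r},
          ‖∫ ξ : E2, Complex.exp (Complex.I * ((⟪y, ξ⟫ : ℝ) : ℂ)) * ((G ξ : ℝ) : ℂ)‖ ^ 4) ^
        ((1 : ℝ) / 4) := by
  have hset : {y : E2 | ‖y‖ ≤ ε / r} = Metric.closedBall 0 (ε / r) := by
    ext y
    simp
  have hρ : 0 ≤ ε / r := by positivity
  have hM : 0 ≤ (1 - ε) * ∫ ξ, G ξ := mul_nonneg (by linarith) (integral_nonneg hG0)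
  have hvol : volume.real (Metric.closedBall (0 : E2) (ε / r)) = Real.pi * (ε / r) ^ 2 := by
    rw [Measure.real, EuclideanSpace.volume_closedBall_fin_two]
    simp [hρ, Real.pi_nonneg, mul_comm]
  have hlow : ((1 - ε) * ∫ ξ, G ξ) ^ 4 * (Real.pi * (ε / r) ^ 2) ≤
      ∫ y in Metric.closedBall (0 : E2) (ε / r),
        ‖∫ ξ : E2, Complex.exp (Complex.I * ((⟪y, ξ⟫ : ℝ) : ℂ)) * ((G ξ : ℝ) : ℂ)‖ ^ 4 := by
    rw [← hvol]
    refine setIntegral_ge_of_const_le_real measurableSet_closedBall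
      measure_closedBall_lt_top.ne (fun y hy => ?_) ?_
    · exact pow_le_pow_left₀ hM (one_sub_mul_integral_le_norm_integral_exp_inner_mul hr hG hG0
        hGsupp (mem_closedBall_zero_iff.mp hy)) 4
    · exact ((continuous_integral_exp_inner_mul hG).norm.pow 4).continuousOn.integrableOn_compact
        (isCompact_closedBall _ _)
  rw [hset]
  refine le_trans (le_of_eq ?_) (Real.rpow_le_rpow (by positivity) hlow (by norm_num))
  rw [Real.mul_rpow (by positivity) (by positivity), Real.mul_rpow Real.pi_nonneg (by positivity),
    ← Real.rpow_natCast_mul hM, ← Real.rpow_natCast_mul hρ]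
  norm_num
  ring
end
end
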